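/- Let X be an infinite, connected, vertex-transitive, uniformly locally finite graph. Then Z^suf_1(X,ℤ) ≠ 𝒞_∞(X,ℤ) (equivalently, H^uf_1(X,ℤ) ≠ 0) if and only if at least one of the following holds: (1) X has more than one end, i.e., some finite K ⊆ V(X) is such that X − K has at least two infinite connected components; (2) X has ℤ-large circuits, i.e., 𝒞_r(X,ℤ) ≠ 𝒞_∞(X,ℤ) for every r; (3) X does not have pure H^uf_1-expansion, i.e., it is not the case that the Rips graphs R_sX have pure H^suf_1-expansion for all sufficiently large s. -/

import Mathlib

open scoped Classical

namespace UFH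

variable {V : Type}

/-- Uniform local finiteness: a uniform bound on vertex degrees. -/
def ULF (G : SimpleGraph V) : Prop :=
  ∃ D : ℕ, ∀ v : V, (G.neighborSet v).Finite ∧ (G.neighborSet v).ncard ≤ D

/-- An integer 1-chain: antisymmetric and supported on adjacent pairs. -/
def IsChain1 (G : SimpleGraph V) (f : V → V → ℤ) : Prop :=
  (∀ u v, f u v = - f v u) ∧ ∀ u v, f u v ≠ 0 → G.Adj u v

/-- A mod-2 1-chain: symmetric and supported on adjacent pairs. -/
def IsChain1Z2 (G : SimpleGraph V) (f : V → V → ZMod 2) : Prop :=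
  (∀ u v, f u v = f v u) ∧ ∀ u v, f u v ≠ 0 → G.Adj u v

/-- Divergence of an integer 1-chain at a vertex. -/
noncomputable def chainDiv (f : V → V → ℤ) (v : V) : ℤ := ∑ᶠ u, f u v

/-- Divergence of a mod-2 1-chain at a vertex. -/
noncomputable def chainDivZ2 (f : V → V → ZMod 2) (v : V) : ZMod 2 := ∑ᶠ u, f u v

def Bdd (f : V → V → ℤ) (C : ℕ) : Prop := ∀ u v, |f u v| ≤ (C : ℤ)

/-- The sup-norm of a bounded integer 1-chain (least uniform bound). -/
noncomputable def chainNorm (f : V → V → ℤ) : ℕ := sInf {C : ℕ | Bdd f C}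

/-- Bounded integer flows: bounded 1-chains with vanishing divergence everywhere. -/
def Zsuf1 (G : SimpleGraph V) : Set (V → V → ℤ) :=
  {f | IsChain1 G f ∧ (∃ C, Bdd f C) ∧ ∀ v, chainDiv f v = 0}

/-- Mod-2 cycles: mod-2 1-chains whose support meets every vertex evenly. -/
def Zsuf1Z2 (G : SimpleGraph V) : Set (V → V → ZMod 2) :=
  {f | IsChain1Z2 G f ∧ ∀ v, chainDivZ2 f v = 0}

/-- A circuit: a closed walk (based at some vertex). -/
abbrev Circuit (G : SimpleGraph V) := Σ v : V, G.Walk v v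

/-- Number of traversals of the oriented edge `(a, b)` by the walk `p`. -/
noncomputable def traversals {G : SimpleGraph V} {u v : V} (p : G.Walk u v) (a b : V) : ℕ :=
  ((Finset.range p.length).filter fun i => p.getVert i = a ∧ p.getVert (i + 1) = b).card

/-- The integer 1-chain of signed traversals of a walk. -/
noncomputable def walkChain {G : SimpleGraph V} {u v : V} (p : G.Walk u v) (a b : V) : ℤ :=
  (traversals p a b : ℤ) - (traversals p b a : ℤ)

/-- The mod-2 1-chain of traversals of a walk. -/
noncomputable def walkChainZ2 {G : SimpleGraph V} {u v : V} (p : G.Walk u v) (a b : V) : ZMod 2 :=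
  (traversals p a b : ZMod 2) + (traversals p b a : ZMod 2)

/-- The walk `p` passes through the edge `{a, b}`. -/
def OnWalk {G : SimpleGraph V} {u v : V} (p : G.Walk u v) (a b : V) : Prop :=
  ∃ i < p.length, (p.getVert i = a ∧ p.getVert (i + 1) = b) ∨
    (p.getVert i = b ∧ p.getVert (i + 1) = a)

/-- A coefficient family on circuits is thin (locally finite). -/
def ThinCoef (G : SimpleGraph V) (g : Circuit G → ℤ) : Prop :=
  ∀ a b : V, {c : Circuit G | g c ≠ 0 ∧ OnWalk c.2 a b}.Finite

def ThinCoefZ2 (G : SimpleGraph V) (g : Circuit G → ZMod 2) : Prop :=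
  ∀ a b : V, {c : Circuit G | g c ≠ 0 ∧ OnWalk c.2 a b}.Finite

/-- The 1-chain obtained as the (pointwise) sum of a family of circuits with coefficients. -/
noncomputable def circSum (G : SimpleGraph V) (g : Circuit G → ℤ) : V → V → ℤ :=
  fun a b => ∑ᶠ c : Circuit G, g c * walkChain c.2 a b

noncomputable def circSumZ2 (G : SimpleGraph V) (g : Circuit G → ZMod 2) : V → V → ZMod 2 :=
  fun a b => ∑ᶠ c : Circuit G, g c * walkChainZ2 c.2 a b

/-- 𝒞_r(X, ℤ): sums of circuits of length ≤ r with uniformly bounded integer coefficients. -/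
def Cr (G : SimpleGraph V) (r : ℕ) : Set (V → V → ℤ) :=
  {f | ∃ g : Circuit G → ℤ, (∃ C : ℕ, ∀ c, |g c| ≤ (C : ℤ)) ∧
    (∀ c, g c ≠ 0 → c.2.length ≤ r) ∧ ThinCoef G g ∧ f = circSum G g}

/-- 𝒞_∞(X, ℤ). -/
def Cinf (G : SimpleGraph V) : Set (V → V → ℤ) := ⋃ r : ℕ, Cr G r

/-- 𝒞(X, ℤ): thin sums of circuits with integer coefficients whose result is bounded. -/
def Cthin (G : SimpleGraph V) : Set (V → V → ℤ) :=
  {f | ∃ g : Circuit G → ℤ, ThinCoef G g ∧ (∃ C, Bdd f C) ∧ f = circSum G g}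

/-- 𝒞_r(X, ℤ₂). -/
def CrZ2 (G : SimpleGraph V) (r : ℕ) : Set (V → V → ZMod 2) :=
  {f | ∃ g : Circuit G → ZMod 2, (∀ c, g c ≠ 0 → c.2.length ≤ r) ∧
    ThinCoefZ2 G g ∧ f = circSumZ2 G g}

/-- 𝒞_∞(X, ℤ₂). -/
def CinfZ2 (G : SimpleGraph V) : Set (V → V → ZMod 2) := ⋃ r : ℕ, CrZ2 G r

/-- 𝒞(X, ℤ₂): thin sums of circuits mod 2. -/
def CthinZ2 (G : SimpleGraph V) : Set (V → V → ZMod 2) :=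
  {f | ∃ g : Circuit G → ZMod 2, ThinCoefZ2 G g ∧ f = circSumZ2 G g}

/-- `a` and `b` are joined by a walk avoiding the set `K`. -/
def ConnAvoiding (G : SimpleGraph V) (K : Set V) (a b : V) : Prop :=
  ∃ p : G.Walk a b, ∀ v ∈ p.support, v ∉ K

/-- A (one-sided infinite) ray in `G`. -/
def IsRay (G : SimpleGraph V) (x : ℕ → V) : Prop :=
  Function.Injective x ∧ ∀ n, G.Adj (x n) (x (n + 1))

/-- Two rays determine the same end. -/
def RayEquiv (G : SimpleGraph V) (x y : ℕ → V) : Prop :=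
  ∀ K : Finset V, ∃ N, ∀ n, N ≤ n → ∀ m, N ≤ m → ConnAvoiding G (↑K) (x n) (y m)

/-- The connected component of `v` in `X − K`. -/
def Component (G : SimpleGraph V) (K : Set V) (v : V) : Set V :=
  {u | u ∉ K ∧ ConnAvoiding G K u v}

def MoreThanOneEnd (G : SimpleGraph V) : Prop :=
  ∃ K : Finset V, ∃ v w : V, v ∉ K ∧ w ∉ K ∧ (Component G (↑K) v).Infinite ∧
    (Component G (↑K) w).Infinite ∧ ¬ ConnAvoiding G (↑K) v w

def OneEnded (G : SimpleGraph V) : Prop :=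
  Infinite V ∧ ∀ K : Finset V, ∃ v, v ∉ K ∧ (Component G (↑K) v).Infinite ∧
    ∀ u, u ∉ K → (Component G (↑K) u).Infinite → ConnAvoiding G (↑K) u v

/-- A bip: a bi-infinite path, i.e. injective graph morphism ℤ → T. -/
def IsBip (T : SimpleGraph V) (b : ℤ → V) : Prop :=
  Function.Injective b ∧ ∀ n : ℤ, T.Adj (b n) (b (n + 1))

/-- The bip `b` lies over the edge `{u, v}`. -/
def LiesOver (b : ℤ → V) (u v : V) : Prop :=
  ∃ n : ℤ, (b n = u ∧ b (n + 1) = v) ∨ (b n = v ∧ b (n + 1) = u)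

/-- The signed traversal of the oriented edge `(u, v)` by the bip `b`. -/
noncomputable def bipSign (b : ℤ → V) (u v : V) : ℤ :=
  if ∃ n : ℤ, b n = u ∧ b (n + 1) = v then 1
  else if ∃ n : ℤ, b n = v ∧ b (n + 1) = u then -1 else 0

noncomputable def bipOverZ2 (b : ℤ → V) (u v : V) : ZMod 2 :=
  if LiesOver b u v then 1 else 0

/-- `p` is the last bip of `P` (w.r.t. the order `r`) lying over the edge `{u, v}`. -/
def IsLast (P : Set (ℤ → V)) (r : (ℤ → V) → (ℤ → V) → Prop) (p : ℤ → V) (u v : V) : Prop :=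
  LiesOver p u v ∧ ∀ q ∈ P, q ≠ p → LiesOver q u v → r q p

/-- The 1-chain associated to coefficients on a family of bips. -/
noncomputable def bipMap (P : Set (ℤ → V)) (f : ↥P → ℤ) : V → V → ℤ :=
  fun u v => ∑ᶠ p : ↥P, f p * bipSign p.1 u v

noncomputable def bipMapZ2 (P : Set (ℤ → V)) (f : ↥P → ZMod 2) : V → V → ZMod 2 :=
  fun u v => ∑ᶠ p : ↥P, f p * bipOverZ2 p.1 u v

/-- The set `S` is connected in the graph `H` (walks staying inside `S`). -/
def ConnectedIn (H : SimpleGraph V) (S : Set V) : Prop :=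
  ∀ a ∈ S, ∀ b ∈ S, ∃ p : H.Walk a b, ∀ v ∈ p.support, v ∈ S

/-- `T` is a subtree of `G`. -/
def IsSubtree (G T : SimpleGraph V) : Prop :=
  T ≤ G ∧ T.IsAcyclic ∧ T.support.Nonempty ∧ ConnectedIn T T.support

/-- Every vertex of `T` has degree ≥ 2 in `T`. -/
def Leafless (T : SimpleGraph V) : Prop :=
  ∀ v ∈ T.support, ∃ u w : V, u ≠ w ∧ T.Adj v u ∧ T.Adj v w

/-- Distinct ends of `T` determine distinct ends of `G`. -/
def EndRespecting (G T : SimpleGraph V) : Prop :=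
  ∀ x y : ℕ → V, IsRay T x → IsRay T y → RayEquiv G x y → RayEquiv T x y

/-- Every end of `G` is represented by a unique end of `T`. -/
def EndDefining (G T : SimpleGraph V) : Prop :=
  EndRespecting G T ∧ ∀ x : ℕ → V, IsRay G x → ∃ y : ℕ → V, IsRay T y ∧ RayEquiv G x y

/-- The subtree `T` of `G` has separators. -/
def HasSeparators (G T : SimpleGraph V) : Prop :=
  ∃ K : ℕ → Finset V,
    (∀ n, K n ⊆ K (n + 1)) ∧
    (∀ v : V, ∃ n, v ∈ K n) ∧
    (∀ n, ConnectedIn G (↑(K n))) ∧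
    (∀ n, ConnectedIn T (T.support ∩ ↑(K n))) ∧
    (∀ n, ∀ v : V, v ∉ K n → (Component G (↑(K n)) v).Infinite →
      ∃! e : V × V, T.Adj e.1 e.2 ∧ e.1 ∈ K n ∧ e.2 ∉ K n ∧
        e.2 ∈ Component G (↑(K n)) v) ∧
    (∀ n, ∀ a b : V, T.Adj a b → a ∈ K n → b ∉ K n → (Component G (↑(K n)) b).Infinite)

/-- An integer 2-chain: alternating, supported on triangles. -/
def IsChain2 (G : SimpleGraph V) (g : V → V → V → ℤ) : Prop :=
  (∀ u v w, g u v w = - g v u w) ∧ (∀ u v w, g u v w = - g u w v) ∧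
    ∀ u v w, g u v w ≠ 0 → G.Adj u v ∧ G.Adj v w ∧ G.Adj u w

def Bdd2 (g : V → V → V → ℤ) (C : ℕ) : Prop := ∀ u v w, |g u v w| ≤ (C : ℤ)

/-- The boundary of a 2-chain. -/
noncomputable def bd2 (g : V → V → V → ℤ) : V → V → ℤ := fun u v => ∑ᶠ w, g u v w

/-- `H^suf_1`-expansion. -/
def HsufExp1 (G : SimpleGraph V) : Prop :=
  ∃ K : ℕ → ℕ, ∀ U : Finset V, ∀ f : V → V → ℤ,
    IsChain1 G f →
    (∀ u v, f u v ≠ 0 → u ∈ U ∧ v ∈ U) →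
    (∀ v ∈ U, (∀ u, G.Adj u v → u ∈ U) → chainDiv f v = 0) →
    (∃ fh ∈ Zsuf1 G, (∀ u ∈ U, ∀ v ∈ U, fh u v = f u v) ∧ chainNorm fh = chainNorm f) →
    ∃ g : V → V → V → ℤ, IsChain2 G g ∧ Bdd2 g (K (chainNorm f)) ∧
      ∀ u ∈ U, ∀ v ∈ U, bd2 g u v = f u v

/-- Pure `H^suf_1`-expansion. -/
def PureHsufExp1 (G : SimpleGraph V) : Prop :=
  ∃ K : ℕ → ℕ, ∀ U : Finset V, ∀ f : V → V → ℤ,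
    IsChain1 G f →
    (∀ u v, f u v ≠ 0 → u ∈ U ∧ v ∈ U) →
    (∀ v ∈ U, (∀ u, G.Adj u v → u ∈ U) → chainDiv f v = 0) →
    (∃ fh : V → V → ℤ, IsChain1 G fh ∧
        (∃ g2 : V → V → V → ℤ, IsChain2 G g2 ∧ (∃ C, Bdd2 g2 C) ∧ bd2 g2 = fh) ∧
        (∀ u ∈ U, ∀ v ∈ U, fh u v = f u v) ∧ chainNorm fh = chainNorm f) →
    ∃ g : V → V → V → ℤ, IsChain2 G g ∧ Bdd2 g (K (chainNorm f)) ∧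
      ∀ u ∈ U, ∀ v ∈ U, bd2 g u v = f u v

/-- The Rips graph of radius `s`. -/
def rips (G : SimpleGraph V) (s : ℕ) : SimpleGraph V :=
  SimpleGraph.fromRel fun u v => G.dist u v ≤ s

/-- Pure `H^uf_1`-expansion: the Rips graphs eventually have pure `H^suf_1`-expansion. -/
def PureHufExp1 (G : SimpleGraph V) : Prop := ∃ s₀ : ℕ, ∀ s, s₀ ≤ s → PureHsufExp1 (rips G s)

def VertexTransitive (G : SimpleGraph V) : Prop := ∀ u v : V, ∃ φ : G ≃g G, φ u = v

/-- The edge boundary of a finite set of vertices. -/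
def edgeBoundary (G : SimpleGraph V) (U : Finset V) : Set (Sym2 V) :=
  {e | e ∈ G.edgeSet ∧ ∃ a b : V, e = s(a, b) ∧ a ∈ U ∧ b ∉ U}

/-- Mod-2 reduction of an integer 1-chain. -/
def mod2 (f : V → V → ℤ) : V → V → ZMod 2 := fun u v => ((f u v : ℤ) : ZMod 2)

/-- Pointwise domination of 1-chains: `r` flows in the same direction as `φ`, no stronger. -/
def chainLE (r φ : V → V → ℤ) : Prop :=
  ∀ u v, (0 ≤ φ u v → 0 ≤ r u v ∧ r u v ≤ φ u v) ∧ (φ u v ≤ 0 → φ u v ≤ r u v ∧ r u v ≤ 0)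

/-- A set of functions is locally finite (thin). -/
def ThinFamily {Y : Type} (F : Set (Y → ZMod 2)) : Prop := ∀ y : Y, {f ∈ F | f y ≠ 0}.Finite

/-- The pointwise sum of a (thin) set of functions. -/
noncomputable def thinSum {Y : Type} (F : Set (Y → ZMod 2)) : Y → ZMod 2 :=
  fun y => ∑ᶠ f : ↥F, f.1 y

/-- A thin-sum space: a subspace closed under thin sums. -/
def IsThinSumSpace {Y : Type} (W : Set (Y → ZMod 2)) : Prop :=
  0 ∈ W ∧ (∀ f ∈ W, ∀ g ∈ W, f + g ∈ W) ∧ ∀ F ⊆ W, ThinFamily F → thinSum F ∈ W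

/-- A thin-sum basis for a thin-sum space. -/
def IsThinSumBasis {Y : Type} (A W : Set (Y → ZMod 2)) : Prop :=
  A ⊆ W ∧ (∀ f ∈ W, ∃ F ⊆ A, ThinFamily F ∧ f = thinSum F) ∧
    ∀ F ⊆ A, ThinFamily F → F.Nonempty → thinSum F ≠ 0

/-- The Kronecker delta. -/
noncomputable def delta (x a : V) : ℤ := if x = a then 1 else 0

/-- The 1-chain of the oriented edge `(x, y)`. -/
noncomputable def elem1 (x y a b : V) : ℤ := delta x a * delta y b - delta x b * delta y a

/-- The 2-chain of the oriented triangle `(x, y, z)`. -/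
noncomputable def elem2 (x y z a b d : V) : ℤ :=
  delta x a * elem1 y z b d - delta x b * elem1 y z a d + delta x d * elem1 y z a b

/-- Every vertex has only finitely many neighbours. -/
def LocFin (H : SimpleGraph V) : Prop := ∀ v, ∃ S : Finset V, ∀ u, H.Adj v u → u ∈ S

/-- All degrees are at most `D`. -/
def DegBdd (H : SimpleGraph V) (D : ℕ) : Prop :=
  ∀ v, ∃ S : Finset V, S.card ≤ D ∧ ∀ u, H.Adj v u → u ∈ S

lemma DegBdd.locFin {H : SimpleGraph V} {D : ℕ} (h : DegBdd H D) : LocFin H :=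
  fun v => (h v).imp fun _ hS => hS.2

/-- `f` is the boundary of a 2-chain of `H` bounded by `C`. -/
def BdOf (H : SimpleGraph V) (C : ℕ) (f : V → V → ℤ) : Prop :=
  ∃ g, IsChain2 H g ∧ Bdd2 g C ∧ bd2 g = f

lemma finsum_eq_sum_of_mem {ι : Type*} {f : ι → ℤ} (S : Finset ι) (h : ∀ x, f x ≠ 0 → x ∈ S) :
    ∑ᶠ x, f x = ∑ x ∈ S, f x :=
  finsum_eq_sum_of_support_subset f fun x hx => h x hx

lemma finsum_swap {ι κ : Type*} {f : ι → κ → ℤ} (S : Finset ι) (T : Finset κ)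
    (h : ∀ x y, f x y ≠ 0 → x ∈ S ∧ y ∈ T) :
    ∑ᶠ x, ∑ᶠ y, f x y = ∑ᶠ y, ∑ᶠ x, f x y := by
  have h1 : ∀ x, ∑ᶠ y, f x y = ∑ y ∈ T, f x y := fun x =>
    finsum_eq_sum_of_mem T fun y hy => (h x y hy).2
  have h2 : ∀ y, ∑ᶠ x, f x y = ∑ x ∈ S, f x y := fun y =>
    finsum_eq_sum_of_mem S fun x hx => (h x y hx).1
  simp only [h1, h2]
  rw [finsum_eq_sum_of_mem S, finsum_eq_sum_of_mem T, Finset.sum_comm]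
  · intro y hy
    obtain ⟨x, -, hx⟩ := Finset.exists_ne_zero_of_sum_ne_zero hy
    exact (h x y hx).2
  · intro x hx
    obtain ⟨y, -, hy⟩ := Finset.exists_ne_zero_of_sum_ne_zero hx
    exact (h x y hy).1

lemma exists_ne_zero_of_finsum {ι : Type*} {f : ι → ℤ} (h : ∑ᶠ x, f x ≠ 0) : ∃ x, f x ≠ 0 := by
  by_contra! hc
  exact h (by simp [hc])

lemma abs_finsum_le {ι : Type*} {f : ι → ℤ} (S : Finset ι) (h : ∀ x, f x ≠ 0 → x ∈ S) {N C : ℕ}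
    (hN : S.card ≤ N) (hC : ∀ x, |f x| ≤ (C : ℤ)) : |∑ᶠ x, f x| ≤ ((N * C : ℕ) : ℤ) := by
  rw [finsum_eq_sum_of_mem S h]
  calc |∑ x ∈ S, f x| ≤ ∑ x ∈ S, |f x| := Finset.abs_sum_le_sum_abs _ _
    _ ≤ ∑ _x ∈ S, (C : ℤ) := Finset.sum_le_sum fun x _ => hC x
    _ = (S.card : ℤ) * C := by simp
    _ ≤ ((N * C : ℕ) : ℤ) := by
      push_cast
      exact mul_le_mul_of_nonneg_right (by exact_mod_cast hN) (by positivity)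

lemma sum_sum_antisymm {ι : Type*} (S : Finset ι) (f : ι → ι → ℤ)
    (h : ∀ x y, f x y = - f y x) : ∑ x ∈ S, ∑ y ∈ S, f x y = 0 := by
  have h1 : ∑ x ∈ S, ∑ y ∈ S, f x y = - ∑ x ∈ S, ∑ y ∈ S, f x y := by
    conv_lhs => rw [Finset.sum_comm]
    rw [← Finset.sum_neg_distrib]
    refine Finset.sum_congr rfl fun x _ => ?_
    rw [← Finset.sum_neg_distrib]
    exact Finset.sum_congr rfl fun y _ => h y x
  linarith

lemma finsum_elem1_left (y z b : V) : ∑ᶠ d, elem1 y z d b = delta z b - delta y b := by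
  have : ∀ d, elem1 y z d b = delta z b * delta y d + - (delta y b * delta z d) := fun d => by
    unfold elem1; ring
  simp only [this]
  rw [finsum_eq_sum_of_mem {y, z}]
  · by_cases h : y = z
    · subst h; simp [delta]
    · rw [Finset.sum_pair h]; simp [delta, h, Ne.symm h]; ring
  · intro d hd
    by_contra hc
    simp only [Finset.mem_insert, Finset.mem_singleton, not_or] at hc
    simp [delta, Ne.symm hc.1, Ne.symm hc.2] at hd

lemma chainDiv_elem1 (x y v : V) : chainDiv (elem1 x y) v = delta y v - delta x v :=
  finsum_elem1_left x y v

lemma bd2_elem2 (x y z a b : V) :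
    bd2 (elem2 x y z) a b = elem1 x y a b + elem1 y z a b + elem1 z x a b := by
  unfold bd2
  rw [finsum_eq_sum_of_mem {x, y, z}]
  · have hd : ∀ w : V, w ∈ ({x, y, z} : Finset V) → ∑ d ∈ ({x, y, z} : Finset V), delta w d = 1 := by
      intro w hw
      rw [Finset.sum_eq_single w]
      · simp [delta]
      · intro d _ hd; simp [delta, hd.symm]
      · intro h; exact absurd hw h
    have hx := hd x (by simp)
    have hy := hd y (by simp)
    have hz := hd z (by simp)
    have : ∀ d, elem2 x y z a b d = elem1 x y a b * delta z d + elem1 y z a b * delta x d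
        + elem1 z x a b * delta y d := fun d => by
      unfold elem2 elem1; ring
    simp only [this, Finset.sum_add_distrib, ← Finset.mul_sum, hx, hy, hz]
    ring
  · intro d hd
    by_contra hc
    simp only [Finset.mem_insert, Finset.mem_singleton, not_or] at hc
    simp [elem2, elem1, delta, Ne.symm hc.1, Ne.symm hc.2.1, Ne.symm hc.2.2] at hd

lemma abs_delta_le (x a : V) : |delta x a| ≤ 1 := by
  unfold delta; split_ifs <;> simp

lemma abs_elem1_le (x y a b : V) : |elem1 x y a b| ≤ 1 := by
  unfold elem1 delta
  split_ifs <;> simp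

lemma abs_elem2_le (x y z a b d : V) : |elem2 x y z a b d| ≤ 3 := by
  unfold elem2
  have h : ∀ u v w p q r : V, |delta u v * elem1 w p q r| ≤ 1 := fun u v w p q r => by
    rw [abs_mul]
    exact mul_le_one₀ (abs_delta_le _ _) (abs_nonneg _) (abs_elem1_le _ _ _ _)
  have h1 := abs_le.1 (h x a y z b d)
  have h2 := abs_le.1 (h x b y z a d)
  have h3 := abs_le.1 (h x d y z a b)
  rw [abs_le]
  constructor <;> linarith [h1.1, h1.2, h2.1, h2.2, h3.1, h3.2]

lemma elem1_swap (x y a b : V) : elem1 x y a b = - elem1 x y b a := by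
  unfold elem1; ring

lemma elem1_comm (x y a b : V) : elem1 x y a b = - elem1 y x a b := by
  unfold elem1; ring

lemma elem1_self (x a b : V) : elem1 x x a b = 0 := by
  unfold elem1; ring

lemma elem1_ne_zero {x y a b : V} (h : elem1 x y a b ≠ 0) :
    x ≠ y ∧ ((x = a ∧ y = b) ∨ (x = b ∧ y = a)) := by
  refine ⟨fun e => h (by rw [e, elem1_self]), ?_⟩
  by_contra! hc
  apply h
  unfold elem1 delta
  split_ifs <;> simp_all

lemma elem2_ne_zero {x y z a b d : V} (h : elem2 x y z a b d ≠ 0) :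
    a ≠ b ∧ b ≠ d ∧ a ≠ d ∧ (a = x ∨ a = y ∨ a = z) ∧ (b = x ∨ b = y ∨ b = z) ∧
      (d = x ∨ d = y ∨ d = z) := by
  refine ⟨?_, ?_, ?_, ?_, ?_, ?_⟩
  · rintro rfl; apply h; unfold elem2 elem1; ring
  · rintro rfl; apply h; unfold elem2 elem1; ring
  · rintro rfl; apply h; unfold elem2 elem1; ring
  all_goals
    by_contra! hc
    apply h
    simp [elem2, elem1, delta, hc.1.symm, hc.2.1.symm, hc.2.2.symm]

lemma isChain2_elem2 {H : SimpleGraph V} {x y z : V} (hxy : x ≠ y → H.Adj x y)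
    (hyz : y ≠ z → H.Adj y z) (hxz : x ≠ z → H.Adj x z) : IsChain2 H (elem2 x y z) := by
  refine ⟨fun a b d => ?_, fun a b d => ?_, fun a b d h => ?_⟩
  · unfold elem2 elem1; ring
  · unfold elem2 elem1; ring
  · obtain ⟨h1, h2, h3, ha, hb, hd⟩ := elem2_ne_zero h
    have key : ∀ p q : V, p ≠ q → (p = x ∨ p = y ∨ p = z) → (q = x ∨ q = y ∨ q = z) →
        H.Adj p q := by
      intro p q hpq hp hq
      rcases hp with rfl | rfl | rfl <;> rcases hq with rfl | rfl | rfl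
      · exact absurd rfl hpq
      · exact hxy hpq
      · exact hxz hpq
      · exact (hxy hpq.symm).symm
      · exact absurd rfl hpq
      · exact hyz hpq
      · exact (hxz hpq.symm).symm
      · exact (hyz hpq.symm).symm
      · exact absurd rfl hpq
    exact ⟨key a b h1 ha hb, key b d h2 hb hd, key a d h3 ha hd⟩

lemma IsChain2.cycle {H : SimpleGraph V} {g : V → V → V → ℤ} (hg : IsChain2 H g) (u v w : V) :
    g u v w = - g w v u := by
  rw [hg.1 u v w, hg.2.1 v u w, hg.1 v w u]
  ring

lemma isChain1_bd2 {H : SimpleGraph V} {g : V → V → V → ℤ} (hg : IsChain2 H g) :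
    IsChain1 H (bd2 g) := by
  refine ⟨fun u v => ?_, fun u v h => ?_⟩
  · unfold bd2
    rw [← finsum_neg_distrib]
    exact finsum_congr fun w => hg.1 u v w
  · obtain ⟨w, hw⟩ := exists_ne_zero_of_finsum h
    exact (hg.2.2 u v w hw).1

lemma chainDiv_bd2 {H : SimpleGraph V} (hH : LocFin H) {g : V → V → V → ℤ} (hg : IsChain2 H g)
    (v : V) : chainDiv (bd2 g) v = 0 := by
  obtain ⟨S, hS⟩ := hH v
  have h1 : ∀ u, bd2 g u v = ∑ w ∈ S, g u v w := fun u =>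
    finsum_eq_sum_of_mem S fun w hw => hS w (hg.2.2 u v w hw).2.1
  unfold chainDiv
  rw [finsum_eq_sum_of_mem S]
  · simp only [h1]
    exact sum_sum_antisymm S (fun u w => g u v w) fun u w => hg.cycle u v w
  · intro u hu
    exact hS u ((isChain1_bd2 hg).2 u v hu).symm

lemma bdd_bd2 {H : SimpleGraph V} {D : ℕ} (hH : DegBdd H D) {g : V → V → V → ℤ}
    (hg : IsChain2 H g) {C : ℕ} (hC : Bdd2 g C) : Bdd (bd2 g) (D * C) := by
  intro u v
  obtain ⟨S, hS, hS'⟩ := hH u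
  exact abs_finsum_le S (fun w hw => hS' w (hg.2.2 u v w hw).2.2) hS fun w => hC u v w

lemma BdOf.mem_zsuf {H : SimpleGraph V} {D : ℕ} (hH : DegBdd H D) {C : ℕ} {f : V → V → ℤ}
    (h : BdOf H C f) : f ∈ Zsuf1 H := by
  obtain ⟨g, hg, hC, rfl⟩ := h
  exact ⟨isChain1_bd2 hg, ⟨_, bdd_bd2 hH hg hC⟩, chainDiv_bd2 hH.locFin hg⟩

lemma IsChain2.add {H : SimpleGraph V} {g g' : V → V → V → ℤ} (hg : IsChain2 H g)
    (hg' : IsChain2 H g') : IsChain2 H (fun a b d => g a b d + g' a b d) := by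
  refine ⟨fun u v w => ?_, fun u v w => ?_, fun u v w h => ?_⟩
  · simp only [hg.1 u v w, hg'.1 u v w]; ring
  · simp only [hg.2.1 u v w, hg'.2.1 u v w]; ring
  · by_cases h0 : g u v w = 0
    · exact hg'.2.2 u v w (by simpa [h0] using h)
    · exact hg.2.2 u v w h0

lemma bd2_add {H : SimpleGraph V} (hH : LocFin H) {g g' : V → V → V → ℤ} (hg : IsChain2 H g)
    (hg' : IsChain2 H g') (a b : V) :
    bd2 (fun a b d => g a b d + g' a b d) a b = bd2 g a b + bd2 g' a b := by
  obtain ⟨S, hS⟩ := hH a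
  unfold bd2
  have hs := fun w hw => hS w (hg.2.2 a b w hw).2.2
  have hs' := fun w hw => hS w (hg'.2.2 a b w hw).2.2
  have hs2 := fun w hw => hS w ((hg.add hg').2.2 a b w hw).2.2
  rw [finsum_eq_sum_of_mem S hs, finsum_eq_sum_of_mem S hs', finsum_eq_sum_of_mem S hs2,
    Finset.sum_add_distrib]

lemma IsChain2.neg {H : SimpleGraph V} {g : V → V → V → ℤ} (hg : IsChain2 H g) :
    IsChain2 H (fun a b d => - g a b d) :=
  ⟨fun u v w => by simp only [hg.1 u v w], fun u v w => by simp only [hg.2.1 u v w],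
    fun u v w h => hg.2.2 u v w (by simpa using h)⟩

lemma bd2_neg (g : V → V → V → ℤ) (a b : V) : bd2 (fun a b d => - g a b d) a b = - bd2 g a b := by
  unfold bd2
  rw [finsum_neg_distrib]

lemma IsChain2.mono {H H' : SimpleGraph V} (h : H ≤ H') {g : V → V → V → ℤ} (hg : IsChain2 H g) :
    IsChain2 H' g :=
  ⟨hg.1, hg.2.1, fun u v w hw =>
    ⟨h (hg.2.2 u v w hw).1, h (hg.2.2 u v w hw).2.1, h (hg.2.2 u v w hw).2.2⟩⟩

lemma IsChain1.mono {H H' : SimpleGraph V} (h : H ≤ H') {f : V → V → ℤ} (hf : IsChain1 H f) :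
    IsChain1 H' f :=
  ⟨hf.1, fun u v hw => h (hf.2 u v hw)⟩

lemma BdOf.mono {H H' : SimpleGraph V} (h : H ≤ H') {C C' : ℕ} (hC : C ≤ C') {f : V → V → ℤ}
    (hf : BdOf H C f) : BdOf H' C' f := by
  obtain ⟨g, hg, hb, rfl⟩ := hf
  exact ⟨g, hg.mono h, fun u v w => (hb u v w).trans (by exact_mod_cast hC), rfl⟩

/-- A local sum of 2-chains: finitely many terms are visible from each vertex. -/
lemma isChain2_finsum {ι : Type*} {H : SimpleGraph V} (hH : LocFin H) (k : ι → ℤ)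
    (T : ι → V → V → V → ℤ) (S : V → Finset ι)
    (hS : ∀ i a b d, k i * T i a b d ≠ 0 → i ∈ S a)
    (hT : ∀ i, k i ≠ 0 → IsChain2 H (T i)) :
    IsChain2 H (fun a b d => ∑ᶠ i, k i * T i a b d) ∧
      ∀ a b, bd2 (fun a b d => ∑ᶠ i, k i * T i a b d) a b = ∑ᶠ i, k i * bd2 (T i) a b := by
  refine ⟨⟨fun u v w => ?_, fun u v w => ?_, fun u v w h => ?_⟩, fun a b => ?_⟩
  · rw [← finsum_neg_distrib]
    refine finsum_congr fun i => ?_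
    by_cases hi : k i = 0
    · simp [hi]
    · rw [(hT i hi).1 u v w]; ring
  · rw [← finsum_neg_distrib]
    refine finsum_congr fun i => ?_
    by_cases hi : k i = 0
    · simp [hi]
    · rw [(hT i hi).2.1 u v w]; ring
  · obtain ⟨i, hi⟩ := exists_ne_zero_of_finsum h
    exact (hT i (left_ne_zero_of_mul hi)).2.2 u v w (right_ne_zero_of_mul hi)
  · obtain ⟨N, hN⟩ := hH a
    have hadj : ∀ d i, k i * T i a b d ≠ 0 → d ∈ N := fun d i h =>
      hN d ((hT i (left_ne_zero_of_mul h)).2.2 a b d (right_ne_zero_of_mul h)).2.2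
    unfold bd2
    rw [finsum_swap N (S a) fun d i h => ⟨hadj d i h, hS i a b d h⟩]
    refine finsum_congr fun i => ?_
    by_cases hi : k i = 0
    · simp [hi]
    · rw [finsum_eq_sum_of_mem N (hadj · i), finsum_eq_sum_of_mem N, Finset.mul_sum]
      intro d hd
      exact hadj d i (mul_ne_zero hi hd)

lemma exists_ultralimit {ι : Type*} (F : ℕ → ι → ℤ) (C : ℕ) (h : ∀ n i, |F n i| ≤ (C : ℤ)) :
    ∃ L : ι → ℤ, ∀ i, ∀ᶠ n in (Filter.hyperfilter ℕ : Filter ℕ), F n i = L i := by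
  suffices ∀ i, ∃ l : ℤ, ∀ᶠ n in (Filter.hyperfilter ℕ : Filter ℕ), F n i = l by
    choose L hL using this
    exact ⟨L, hL⟩
  intro i
  have h1 := (Ultrafilter.finite_biUnion_mem_iff (f := Filter.hyperfilter ℕ)
    (Set.finite_Icc (-(C : ℤ)) C) (s := fun l => {n | F n i = l})).1 (by
      refine Filter.mem_of_superset Filter.univ_mem fun n _ => ?_
      simpa [and_comm] using abs_le.1 (h n i))
  obtain ⟨l, -, hl⟩ := h1
  exact ⟨l, hl⟩

lemma eventually_hyperfilter {p : ℕ → Prop} (h : ∀ᶠ n in Filter.atTop, p n) :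
    ∀ᶠ n in (Filter.hyperfilter ℕ : Filter ℕ), p n :=
  Nat.hyperfilter_le_atTop h

/-- Compactness: being the boundary of a 2-chain with given bound is a local condition. -/
lemma bdOf_of_local {H : SimpleGraph V} (hH : LocFin H) {f : V → V → ℤ} {C : ℕ}
    (U : ℕ → Finset V) (hU : ∀ v, ∀ᶠ n in Filter.atTop, v ∈ U n)
    (h : ∀ᶠ n in Filter.atTop, ∃ g, IsChain2 H g ∧ Bdd2 g C ∧
      ∀ u ∈ U n, ∀ v ∈ U n, bd2 g u v = f u v) : BdOf H C f := by
  have h' : ∃ g : ℕ → V → V → V → ℤ, (∀ n, IsChain2 H (g n)) ∧ (∀ n, Bdd2 (g n) C) ∧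
      ∀ᶠ n in Filter.atTop, ∀ u ∈ U n, ∀ v ∈ U n, bd2 (g n) u v = f u v := by
    have : ∀ n, ∃ g, IsChain2 H g ∧ Bdd2 g C ∧ ((∃ g, IsChain2 H g ∧ Bdd2 g C ∧
      ∀ u ∈ U n, ∀ v ∈ U n, bd2 g u v = f u v) → ∀ u ∈ U n, ∀ v ∈ U n, bd2 g u v = f u v) := by
      intro n
      by_cases hn : ∃ g, IsChain2 H g ∧ Bdd2 g C ∧ ∀ u ∈ U n, ∀ v ∈ U n, bd2 g u v = f u v
      · obtain ⟨g, h1, h2, h3⟩ := hn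
        exact ⟨g, h1, h2, fun _ => h3⟩
      · exact ⟨fun _ _ _ => 0, ⟨by simp, by simp, by simp⟩, fun _ _ _ => by simp,
          fun h => absurd h hn⟩
    choose g h1 h2 h3 using this
    exact ⟨g, h1, h2, h.mono fun n hn => h3 n hn⟩
  obtain ⟨g, hg, hC, hb⟩ := h'
  obtain ⟨L, hL⟩ := exists_ultralimit (fun n (t : V × V × V) => g n t.1 t.2.1 t.2.2) C
    fun n t => hC n _ _ _
  have hL' : ∀ u v w, ∀ᶠ n in (Filter.hyperfilter ℕ : Filter ℕ), g n u v w = L (u, v, w) :=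
    fun u v w => hL (u, v, w)
  have hch : IsChain2 H (fun u v w => L (u, v, w)) := by
    refine ⟨fun u v w => ?_, fun u v w => ?_, fun u v w hne => ?_⟩
    · obtain ⟨n, h1, h2⟩ := ((hL' u v w).and (hL' v u w)).exists
      simp only
      rw [← h1, ← h2]; exact (hg n).1 u v w
    · obtain ⟨n, h1, h2⟩ := ((hL' u v w).and (hL' u w v)).exists
      simp only
      rw [← h1, ← h2]; exact (hg n).2.1 u v w
    · obtain ⟨n, h1⟩ := (hL' u v w).exists
      exact (hg n).2.2 u v w (by rw [h1]; exact hne)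
  refine ⟨fun u v w => L (u, v, w), hch, fun u v w => ?_, ?_⟩
  · obtain ⟨n, h1⟩ := (hL' u v w).exists
    simp only
    rw [← h1]; exact hC n u v w
  · funext u v
    obtain ⟨S, hS⟩ := hH u
    have e1 : ∀ᶠ n in (Filter.hyperfilter ℕ : Filter ℕ), ∀ w ∈ S, g n u v w = L (u, v, w) :=
      (Filter.eventually_all_finset S).2 fun w _ => hL' u v w
    obtain ⟨n, h1, h2⟩ := (e1.and (eventually_hyperfilter ((hU u).and ((hU v).and hb)))).exists
    rw [← h2.2.2 u h2.1 v h2.2.1]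
    unfold bd2
    rw [finsum_eq_sum_of_mem S fun w hw => hS w (hch.2.2 u v w hw).2.2,
      finsum_eq_sum_of_mem S fun w hw => hS w ((hg n).2.2 u v w hw).2.2]
    exact (Finset.sum_congr rfl fun w hw => h1 w hw).symm

lemma ULF.locFin {G : SimpleGraph V} (h : ULF G) : LocFin G := by
  obtain ⟨D, hD⟩ := h
  exact fun v => ⟨(hD v).1.toFinset, fun u hu => by simpa using hu⟩

lemma rips_adj {G : SimpleGraph V} {s : ℕ} {u v : V} :
    (rips G s).Adj u v ↔ u ≠ v ∧ G.dist u v ≤ s := by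
  simp [rips, SimpleGraph.fromRel_adj, SimpleGraph.dist_comm (u := v) (v := u)]

lemma rips_mono (G : SimpleGraph V) {s t : ℕ} (h : s ≤ t) : rips G s ≤ rips G t := by
  intro u v huv
  rw [rips_adj] at *
  exact ⟨huv.1, huv.2.trans h⟩

lemma le_rips (G : SimpleGraph V) {s : ℕ} (h : 1 ≤ s) : G ≤ rips G s := by
  intro u v huv
  rw [rips_adj]
  exact ⟨huv.ne, (SimpleGraph.dist_eq_one_iff_adj.2 huv).le.trans h⟩

lemma finite_ball {G : SimpleGraph V} (hG : LocFin G) (hconn : G.Connected) (a : V) (R : ℕ) :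
    {v | G.dist a v ≤ R}.Finite := by
  induction R with
  | zero =>
    refine (Set.finite_singleton a).subset fun v hv => ?_
    have : G.dist a v = 0 := by simpa using hv
    exact (hconn.dist_eq_zero_iff.1 this).symm
  | succ R ih =>
    choose N hN using hG
    refine (ih.union (ih.biUnion fun u _ => (N u).finite_toSet)).subset fun v hv => ?_
    by_cases hR : G.dist a v ≤ R
    · exact Or.inl hR
    · right
      have hv' : G.dist a v = R + 1 := le_antisymm hv (by omega)
      obtain ⟨p, hp⟩ := hconn.exists_walk_length_eq_dist a v
      rw [hv'] at hp
      simp only [Set.mem_iUnion]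
      refine ⟨p.getVert R, ?_, ?_⟩
      · have := SimpleGraph.dist_le (p.take R)
        simpa [hp] using this
      · apply hN
        have := p.adj_getVert_succ (i := R) (by omega)
        rwa [← hp, p.getVert_length] at this

/-- The ball of radius `R`. -/
noncomputable def ballF (G : SimpleGraph V) (a : V) (R : ℕ) : Finset V :=
  if h : {v | G.dist a v ≤ R}.Finite then h.toFinset else ∅

lemma mem_ballF {G : SimpleGraph V} (hG : LocFin G) (hconn : G.Connected) {a v : V} {R : ℕ} :
    v ∈ ballF G a R ↔ G.dist a v ≤ R := by
  unfold ballF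
  rw [dif_pos (finite_ball hG hconn a R)]
  simp

lemma eventually_mem_ballF {G : SimpleGraph V} (hG : LocFin G) (hconn : G.Connected) (a v : V) :
    ∀ᶠ n in Filter.atTop, v ∈ ballF G a n := by
  filter_upwards [Filter.eventually_ge_atTop (G.dist a v)] with n hn
  exact (mem_ballF hG hconn).2 hn

lemma dist_map_le {G : SimpleGraph V} (hconn : G.Connected) (φ : G →g G) (u v : V) :
    G.dist (φ u) (φ v) ≤ G.dist u v := by
  obtain ⟨p, hp⟩ := hconn.exists_walk_length_eq_dist u v
  rw [← hp]
  simpa using SimpleGraph.dist_le (p.map φ)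

lemma dist_iso {G : SimpleGraph V} (hconn : G.Connected) (φ : G ≃g G) (u v : V) :
    G.dist (φ u) (φ v) = G.dist u v := by
  refine le_antisymm (dist_map_le hconn φ.toHom u v) ?_
  simpa using dist_map_le hconn φ.symm.toHom (φ u) (φ v)

lemma exists_card_ballF_le {G : SimpleGraph V} (hG : LocFin G) (hconn : G.Connected)
    (htrans : VertexTransitive G) (R : ℕ) : ∃ N, ∀ a, (ballF G a R).card ≤ N := by
  obtain ⟨o⟩ := hconn.nonempty
  refine ⟨(ballF G o R).card, fun a => ?_⟩
  obtain ⟨φ, hφ⟩ := htrans a o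
  refine Finset.card_le_card_of_injOn φ (fun v hv => ?_) φ.injective.injOn
  have hv' := (mem_ballF hG hconn).1 hv
  refine (mem_ballF hG hconn).2 ?_
  rw [← hφ, dist_iso hconn]
  exact hv'

lemma exists_degBdd_rips {G : SimpleGraph V} (hG : LocFin G) (hconn : G.Connected)
    (htrans : VertexTransitive G) (s : ℕ) : ∃ D, DegBdd (rips G s) D := by
  obtain ⟨N, hN⟩ := exists_card_ballF_le hG hconn htrans s
  exact ⟨N, fun v => ⟨ballF G v s, hN v, fun u hu => (mem_ballF hG hconn).2 (rips_adj.1 hu).2⟩⟩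

/-- A finite set can be moved off another finite set by an automorphism. -/
lemma exists_disjoint_translate {G : SimpleGraph V} (hinf : Infinite V) (hG : LocFin G)
    (hconn : G.Connected) (htrans : VertexTransitive G) (S T : Finset V) :
    ∃ φ : G ≃g G, ∀ v ∈ S, φ v ∉ T := by
  obtain ⟨o⟩ := hconn.nonempty
  obtain ⟨R, hR⟩ : ∃ R, ∀ v ∈ S, G.dist v o ≤ R :=
    ⟨S.sup fun v => G.dist v o, fun v hv => Finset.le_sup (f := fun v => G.dist v o) hv⟩
  obtain ⟨y, hy⟩ := (T.biUnion fun t => ballF G t R).exists_notMem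
  obtain ⟨φ, rfl⟩ := htrans o y
  refine ⟨φ, fun v hv hT => hy ?_⟩
  rw [Finset.mem_biUnion]
  refine ⟨_, hT, (mem_ballF hG hconn).2 ?_⟩
  rw [dist_iso hconn]
  exact hR v hv

/-- Finitely supported chains on far apart translates add up to one bounded flow. -/
lemma exists_flow_of_translates {G H : SimpleGraph V} (hinf : Infinite V) (hG : LocFin G)
    (hconn : G.Connected) (htrans : VertexTransitive G)
    (hinv : ∀ φ : G ≃g G, ∀ u v, H.Adj u v → H.Adj (φ u) (φ v)) (M : ℕ)
    (F : ℕ → V → V → ℤ) (S : ℕ → Finset V) (hF : ∀ n, IsChain1 H (F n))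
    (hS : ∀ n u v, F n u v ≠ 0 → u ∈ S n ∧ v ∈ S n) (hdiv : ∀ n v, chainDiv (F n) v = 0)
    (hM : ∀ n, Bdd (F n) M) :
    ∃ f ∈ Zsuf1 H, ∃ φ : ℕ → G ≃g G, ∀ n, ∀ u ∈ S n, ∀ v, f (φ n u) (φ n v) = F n u v := by
  choose ch hch using exists_disjoint_translate hinf hG hconn htrans
  let T : ℕ → Finset V := fun n => Nat.rec ∅ (fun n T => T ∪ (S n).image (ch (S n) T)) n
  have hT : ∀ n, T (n + 1) = T n ∪ (S n).image (ch (S n) (T n)) := fun n => rfl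
  let φ : ℕ → G ≃g G := fun n => ch (S n) (T n)
  have hTmono : Monotone T := monotone_nat_of_le_succ fun n => by
    rw [hT]; exact Finset.subset_union_left
  have hlt : ∀ m n v, m < n → (φ m).symm v ∈ S m → (φ n).symm v ∈ S n → False := by
    intro m n v hmn hm hn
    have h1 : v ∈ T (m + 1) := by
      rw [hT, Finset.mem_union, Finset.mem_image]
      exact Or.inr ⟨_, hm, (φ m).apply_symm_apply v⟩
    have h2 := hch (S n) (T n) _ hn
    have h3 : ch (S n) (T n) ((φ n).symm v) = v := (φ n).apply_symm_apply v
    rw [h3] at h2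
    exact h2 (hTmono hmn h1)
  have hdisj : ∀ m n v, (φ m).symm v ∈ S m → (φ n).symm v ∈ S n → m = n := by
    intro m n v hm hn
    rcases lt_trichotomy m n with h | h | h
    · exact (hlt m n v h hm hn).elim
    · exact h
    · exact (hlt n m v h hn hm).elim
  let f : V → V → ℤ := fun u v => ∑ᶠ n, F n ((φ n).symm u) ((φ n).symm v)
  have hanti : ∀ u v, f u v = - f v u := fun u v => by
    simp only [f]
    rw [← finsum_neg_distrib]
    exact finsum_congr fun n => (hF n).1 _ _
  have hsing : ∀ n u v, (φ n).symm u ∈ S n → f u v = F n ((φ n).symm u) ((φ n).symm v) := by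
    intro n u v hu
    refine finsum_eq_single _ n fun m hm => ?_
    by_contra hne
    exact hm (hdisj m n u (hS m _ _ hne).1 hu)
  have hzero : ∀ u, (∀ n, (φ n).symm u ∉ S n) → ∀ v, f u v = 0 := by
    intro u hu v
    by_contra hne
    obtain ⟨n, hn⟩ := exists_ne_zero_of_finsum hne
    exact hu n (hS n _ _ hn).1
  refine ⟨f, ⟨⟨hanti, fun u v h => ?_⟩, ⟨M, fun u v => ?_⟩, fun v => ?_⟩, φ,
    fun n u hu v => ?_⟩
  · obtain ⟨n, hn⟩ := exists_ne_zero_of_finsum h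
    simpa using hinv (φ n) _ _ ((hF n).2 _ _ hn)
  · by_cases hu : ∃ n, (φ n).symm u ∈ S n
    · obtain ⟨n, hn⟩ := hu
      rw [hsing n u v hn]
      exact hM n _ _
    · rw [hzero u (by simpa using hu)]
      simp
  · unfold chainDiv
    by_cases hu : ∃ n, (φ n).symm v ∈ S n
    · obtain ⟨n, hn⟩ := hu
      have : ∀ u, f u v = F n ((φ n).symm u) ((φ n).symm v) := fun u => by
        rw [hanti, hsing n v u hn, ← (hF n).1]
      simp only [this]
      exact (finsum_comp_equiv (φ n).symm.toEquiv (f := fun u => F n u ((φ n).symm v))).trans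
        (hdiv n _)
    · have : ∀ u, f u v = 0 := fun u => by
        rw [hanti, hzero v (by simpa using hu), neg_zero]
      simp [this]
  · rw [hsing n _ _ (by simpa using hu)]
    simp

/-- Finitely supported chains below the capacity `c`. -/
def Feasible (H : SimpleGraph V) (c h : V → V → ℤ) : Prop :=
  IsChain1 H h ∧ (∃ S : Finset V, ∀ u v, h u v ≠ 0 → u ∈ S ∧ v ∈ S) ∧
    ∀ a b, H.Adj a b → h a b ≤ c a b

/-- Total excess of a chain. -/
noncomputable def excess (h : V → V → ℤ) : ℤ := ∑ᶠ v, |chainDiv h v|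

lemma chainDiv_eq_zero_of_notMem {h : V → V → ℤ} {S : Finset V}
    (hS : ∀ u v, h u v ≠ 0 → u ∈ S ∧ v ∈ S) {v : V} (hv : v ∉ S) : chainDiv h v = 0 := by
  by_contra hne
  obtain ⟨u, hu⟩ := exists_ne_zero_of_finsum hne
  exact hv (hS u v hu).2

lemma chainDiv_add_elem1 {h : V → V → ℤ} {S : Finset V}
    (hS : ∀ u v, h u v ≠ 0 → u ∈ S ∧ v ∈ S) (x y v : V) :
    chainDiv (fun a b => h a b + elem1 x y a b) v = chainDiv h v + delta y v - delta x v := by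
  have := chainDiv_elem1 x y v
  unfold chainDiv at *
  rw [finsum_add_distrib, this]
  · ring
  · exact S.finite_toSet.subset fun u hu => (hS u v hu).1
  · refine ({x, y} : Finset V).finite_toSet.subset fun u hu => ?_
    obtain ⟨-, ⟨h1, -⟩ | ⟨-, h2⟩⟩ := elem1_ne_zero hu
    · simp [h1]
    · simp [h2]

lemma excess_add_elem1 {h : V → V → ℤ} {S : Finset V}
    (hS : ∀ u v, h u v ≠ 0 → u ∈ S ∧ v ∈ S) {x y : V} (hxy : x ≠ y) :
    excess (fun a b => h a b + elem1 x y a b) =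
      excess h + (|chainDiv h x - 1| - |chainDiv h x|) + (|chainDiv h y + 1| - |chainDiv h y|) := by
  unfold excess
  have hpt : ∀ v, |chainDiv (fun a b => h a b + elem1 x y a b) v| = |chainDiv h v| +
      (delta x v * (|chainDiv h x - 1| - |chainDiv h x|) +
        delta y v * (|chainDiv h y + 1| - |chainDiv h y|)) := by
    intro v
    rw [chainDiv_add_elem1 hS]
    by_cases hx : x = v
    · subst hx; simp [delta, hxy.symm]
    · by_cases hy : y = v
      · subst hy; simp [delta, hx]
      · simp [delta, hx, hy]
  have hd : ∀ w, w ∈ ({x, y} : Finset V) → ∑ v ∈ S ∪ {x, y}, delta w v = 1 := by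
    intro w hw
    rw [Finset.sum_eq_single w]
    · simp [delta]
    · intro v _ hv; simp [delta, hv.symm]
    · intro h; exact absurd (Finset.mem_union_right _ hw) h
  have hsupp : ∀ v, |chainDiv h v| ≠ 0 → v ∈ S ∪ {x, y} := by
    intro v hv
    by_contra hc
    rw [chainDiv_eq_zero_of_notMem hS fun h => hc (Finset.mem_union_left _ h)] at hv
    simp at hv
  simp only [hpt]
  rw [finsum_eq_sum_of_mem _ hsupp, finsum_eq_sum_of_mem (S ∪ {x, y}), Finset.sum_add_distrib,
    Finset.sum_add_distrib, ← Finset.sum_mul, ← Finset.sum_mul, hd x (by simp), hd y (by simp)]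
  · ring
  · intro v hv
    by_contra hc
    have h1 : |chainDiv h v| = 0 := by
      by_contra h1; exact hc (hsupp v h1)
    simp only [Finset.mem_union, Finset.mem_insert, Finset.mem_singleton, not_or] at hc
    apply hv
    simp [h1, delta, Ne.symm hc.2.1, Ne.symm hc.2.2]

lemma elem1_le (x y a b : V) : elem1 x y a b ≤ 0 ∨ (a = x ∧ b = y) := by
  by_cases h : elem1 x y a b = 0
  · exact Or.inl h.le
  · obtain ⟨hne, ⟨rfl, rfl⟩ | ⟨rfl, rfl⟩⟩ := elem1_ne_zero h
    · exact Or.inr ⟨rfl, rfl⟩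
    · left; simp [elem1, delta, hne, hne.symm]

/-- Pushing one unit along a residual path decreases the excess. -/
lemma exists_smaller_excess {H : SimpleGraph V} {c : V → V → ℤ} (n : ℕ) :
    ∀ (h : V → V → ℤ) (p : ℕ → V), Feasible H c h → 0 < chainDiv h (p 0) →
      chainDiv h (p n) < 0 →
      (∀ i < n, H.Adj (p i) (p (i + 1)) ∧ h (p i) (p (i + 1)) < c (p i) (p (i + 1))) →
      ∃ h', Feasible H c h' ∧ excess h' < excess h := by
  induction n using Nat.strong_induction_on with
  | _ n ih =>
  intro h p hh h0 hn hp
  obtain _ | m := n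
  · exact absurd hn (not_lt.2 h0.le)
  by_cases hrep : ∃ j, 0 < j ∧ j ≤ m + 1 ∧ p j = p 0
  · obtain ⟨j, hj, hjm, hpj⟩ := hrep
    refine ih (m + 1 - j) (by omega) h (fun i => p (i + j)) hh (by simpa [hpj] using h0)
      (by simpa [Nat.sub_add_cancel hjm] using hn) fun i hi => ?_
    have := hp (i + j) (by omega)
    rwa [show i + j + 1 = i + 1 + j by omega] at this
  · push Not at hrep
    have h10 : p 0 ≠ p 1 := (hrep 1 one_pos (by omega)).symm
    obtain ⟨hch, ⟨S, hS⟩, hc⟩ := hh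
    obtain ⟨hadj, hlt⟩ := hp 0 (by omega)
    rw [zero_add] at hadj hlt
    let h' : V → V → ℤ := fun a b => h a b + elem1 (p 0) (p 1) a b
    have hle : ∀ a b, ¬ (a = p 0 ∧ b = p 1) → h' a b ≤ h a b := by
      intro a b hab
      have := (elem1_le (p 0) (p 1) a b).resolve_right hab
      simp only [h']; linarith
    have hfeas : Feasible H c h' := by
      refine ⟨⟨fun u v => ?_, fun u v huv => ?_⟩, ⟨S ∪ {p 0, p 1}, fun u v huv => ?_⟩,
        fun a b hab => ?_⟩
      · simp only [h']; rw [hch.1 u v, elem1_swap]; ring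
      · by_cases hz : h u v = 0
        · have : elem1 (p 0) (p 1) u v ≠ 0 := by simpa [h', hz] using huv
          obtain ⟨-, ⟨rfl, rfl⟩ | ⟨rfl, rfl⟩⟩ := elem1_ne_zero this
          · exact hadj
          · exact hadj.symm
        · exact hch.2 u v hz
      · by_cases hz : h u v = 0
        · have : elem1 (p 0) (p 1) u v ≠ 0 := by simpa [h', hz] using huv
          obtain ⟨-, ⟨rfl, rfl⟩ | ⟨rfl, rfl⟩⟩ := elem1_ne_zero this <;> simp
        · exact ⟨Finset.mem_union_left _ (hS u v hz).1, Finset.mem_union_left _ (hS u v hz).2⟩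
      · by_cases hab' : a = p 0 ∧ b = p 1
        · obtain ⟨rfl, rfl⟩ := hab'
          have := (abs_le.1 (abs_elem1_le (p 0) (p 1) (p 0) (p 1))).2
          simp only [h']; linarith
        · exact (hle a b hab').trans (hc a b hab)
    have hex := excess_add_elem1 hS h10
    have e0 : |chainDiv h (p 0) - 1| - |chainDiv h (p 0)| = -1 := by
      rw [abs_of_nonneg (by omega), abs_of_pos h0]; ring
    have hd : ∀ v, chainDiv h' v = chainDiv h v + delta (p 1) v - delta (p 0) v :=
      chainDiv_add_elem1 hS (p 0) (p 1)
    by_cases h1 : chainDiv h (p 1) < 0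
    · refine ⟨h', hfeas, ?_⟩
      have e1 : |chainDiv h (p 1) + 1| - |chainDiv h (p 1)| = -1 := by
        rw [abs_of_nonpos (by omega), abs_of_neg h1]; ring
      change excess h' = _ at hex
      rw [hex, e0, e1]; omega
    · have e1 : |chainDiv h (p 1) + 1| - |chainDiv h (p 1)| = 1 := by
        rw [abs_of_nonneg (by omega), abs_of_nonneg (by omega)]; ring
      have hn1 : p (m + 1) ≠ p 1 := fun e => h1 (e ▸ hn)
      have hn0 := hrep (m + 1) (by omega) le_rfl
      obtain ⟨h'', hf'', hlt''⟩ := ih m (by omega) h' (fun i => p (i + 1)) hfeas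
        (by rw [zero_add, hd]; simp [delta, h10]; omega)
        (by simpa [hd, delta, hn1.symm, hn0.symm] using hn) fun i hi => by
          refine ⟨(hp (i + 1) (by omega)).1, (hle _ _ fun hc => ?_).trans_lt (hp (i + 1) (by omega)).2⟩
          exact hrep (i + 1) (by omega) (by omega) hc.1
      refine ⟨h'', hf'', hlt''.trans_le ?_⟩
      change excess h' = _ at hex
      rw [hex, e0, e1]; omega

lemma sum_chainDiv_nonneg {H : SimpleGraph V} (hH : LocFin H) {h : V → V → ℤ}
    (hh : IsChain1 H h) (A : Finset V) (hA : ∀ a ∈ A, ∀ b ∉ A, 0 ≤ h b a) :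
    0 ≤ ∑ a ∈ A, chainDiv h a := by
  choose N hN using hH
  have h1 : ∀ a ∈ A, chainDiv h a = ∑ u ∈ A, h u a + ∑ u ∈ (A.biUnion N) \ A, h u a := by
    intro a ha
    unfold chainDiv
    rw [finsum_eq_sum_of_mem (A ∪ (A.biUnion N) \ A), Finset.sum_union Finset.disjoint_sdiff]
    intro u hu
    by_cases hu' : u ∈ A
    · exact Finset.mem_union_left _ hu'
    · refine Finset.mem_union_right _ (Finset.mem_sdiff.2 ⟨Finset.mem_biUnion.2 ⟨a, ha, ?_⟩, hu'⟩)
      exact hN a u (hh.2 u a hu).symm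
  rw [Finset.sum_congr rfl h1, Finset.sum_add_distrib,
    sum_sum_antisymm A (fun a u => h u a) fun a u => hh.1 u a, zero_add]
  exact Finset.sum_nonneg fun a ha => Finset.sum_nonneg fun b hb =>
    hA a ha b (Finset.mem_sdiff.1 hb).2

lemma sum_chainDiv_eq_zero {H : SimpleGraph V} (hH : LocFin H) {h : V → V → ℤ}
    (hh : IsChain1 H h) {S : Finset V} (hS : ∀ u v, h u v ≠ 0 → u ∈ S ∧ v ∈ S) :
    ∑ a ∈ S, chainDiv h a = 0 := by
  have key : ∀ k : V → V → ℤ, IsChain1 H k → (∀ u v, k u v ≠ 0 → u ∈ S ∧ v ∈ S) →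
      0 ≤ ∑ a ∈ S, chainDiv k a := fun k hk hS' =>
    sum_chainDiv_nonneg hH hk S fun a _ b hb => by
      by_contra hc
      exact hb (hS' b a fun e => hc e.ge).1
  have h2 := key (fun u v => - h u v) ⟨fun u v => by simp only [hh.1 u v],
    fun u v huv => hh.2 u v (by simpa using huv)⟩ fun u v huv => hS u v (by simpa using huv)
  have h3 : ∀ a, chainDiv (fun u v => - h u v) a = - chainDiv h a := fun a => by
    unfold chainDiv; rw [finsum_neg_distrib]
  simp only [h3, Finset.sum_neg_distrib] at h2
  linarith [key h hh hS]

lemma exists_path_of_reflTransGen {r : V → V → Prop} {x y : V} (h : Relation.ReflTransGen r x y) :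
    ∃ (n : ℕ) (p : ℕ → V), p 0 = x ∧ p n = y ∧ ∀ i < n, r (p i) (p (i + 1)) := by
  induction h using Relation.ReflTransGen.head_induction_on with
  | refl => exact ⟨0, fun _ => y, rfl, rfl, by simp⟩
  | @head a b hab _ ih =>
    obtain ⟨n, p, h0, hn, hp⟩ := ih
    refine ⟨n + 1, fun i => Nat.casesOn i a p, rfl, hn, fun i hi => ?_⟩
    obtain _ | i := i
    · simpa [h0] using hab
    · exact hp i (by omega)

/-- A circulation criterion: a finitely supported flow below `c` exists as soon as no saturated
cut obstructs it. -/
lemma exists_feasible_flow {H : SimpleGraph V} (hH : LocFin H) {c h₀ : V → V → ℤ}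
    (h0 : Feasible H c h₀)
    (hcut : ∀ h, Feasible H c h → ∀ A : Set V,
      (∀ a ∈ A, ∀ b ∉ A, H.Adj a b → h a b = c a b) → (∀ a ∈ A, 0 ≤ chainDiv h a) →
      ∀ a ∈ A, chainDiv h a ≤ 0) :
    ∃ h, Feasible H c h ∧ ∀ v, chainDiv h v = 0 := by
  obtain ⟨h, hh, hmin⟩ : ∃ h, Feasible H c h ∧ ∀ h', Feasible H c h' → excess h ≤ excess h' := by
    have hnn : ∀ h : V → V → ℤ, 0 ≤ excess h := fun h => finsum_nonneg fun v => abs_nonneg _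
    obtain ⟨n, hn⟩ : ∃ n : ℕ, ∃ h, Feasible H c h ∧ excess h = n :=
      ⟨(excess h₀).toNat, h₀, h0, (Int.toNat_of_nonneg (hnn _)).symm⟩
    have hex : ∃ n : ℕ, ∃ h, Feasible H c h ∧ excess h = n := ⟨n, hn⟩
    obtain ⟨h, hh, he⟩ := Nat.find_spec hex
    refine ⟨h, hh, fun h' hh' => ?_⟩
    have := Nat.find_min' hex ⟨h', hh', (Int.toNat_of_nonneg (hnn h')).symm⟩
    rw [he]
    have h2 := Int.toNat_of_nonneg (hnn h')
    omega
  refine ⟨h, hh, ?_⟩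
  obtain ⟨hch, ⟨S, hS⟩, hc⟩ := hh
  have hle : ∀ v, chainDiv h v ≤ 0 := by
    intro x
    by_contra hx
    push Not at hx
    let A : Set V := {y | Relation.ReflTransGen (fun a b => H.Adj a b ∧ h a b < c a b) x y}
    have hA : ∀ a ∈ A, 0 ≤ chainDiv h a := by
      intro y hy
      by_contra hneg
      push Not at hneg
      obtain ⟨n, p, rfl, rfl, hp⟩ := exists_path_of_reflTransGen hy
      obtain ⟨h', hf, hlt⟩ := exists_smaller_excess n h p ⟨hch, ⟨S, hS⟩, hc⟩ hx hneg hp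
      exact absurd (hmin h' hf) (not_le.2 hlt)
    refine absurd (hcut h ⟨hch, ⟨S, hS⟩, hc⟩ A (fun a ha b hb hab => ?_) hA x
      Relation.ReflTransGen.refl) (not_le.2 hx)
    by_contra hne
    exact hb (Relation.ReflTransGen.tail ha ⟨hab, lt_of_le_of_ne (hc a b hab) hne⟩)
  intro v
  by_cases hv : v ∈ S
  · exact (Finset.sum_eq_zero_iff_of_nonpos fun a _ => hle a).1 (sum_chainDiv_eq_zero hH hch hS) v hv
  · exact chainDiv_eq_zero_of_notMem hS hv

/-- Finitely supported flows. -/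
def FinFlow (H : SimpleGraph V) (F : V → V → ℤ) : Prop :=
  IsChain1 H F ∧ (∃ S : Finset V, ∀ u v, F u v ≠ 0 → u ∈ S ∧ v ∈ S) ∧ ∀ v, chainDiv F v = 0

/-- Sets with finite boundary are finite or cofinite. -/
def CutFin (H : SimpleGraph V) : Prop :=
  ∀ A : Set V, {p : V × V | H.Adj p.1 p.2 ∧ p.1 ∈ A ∧ p.2 ∉ A}.Finite → A.Finite ∨ Aᶜ.Finite

lemma chainDiv_sub_mul {H : SimpleGraph V} (hH : LocFin H) {f h : V → V → ℤ} (hf : IsChain1 H f)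
    (hh : IsChain1 H h) (m : ℤ) (v : V) :
    chainDiv (fun a b => f a b - m * h a b) v = chainDiv f v - m * chainDiv h v := by
  obtain ⟨S, hS⟩ := hH v
  have h1 : ∀ u, f u v ≠ 0 → u ∈ S := fun u hu => hS u (hf.2 u v hu).symm
  have h2 : ∀ u, h u v ≠ 0 → u ∈ S := fun u hu => hS u (hh.2 u v hu).symm
  unfold chainDiv
  rw [finsum_eq_sum_of_mem S h1, finsum_eq_sum_of_mem S h2, finsum_eq_sum_of_mem S,
    Finset.mul_sum, Finset.sum_sub_distrib]
  intro u hu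
  by_contra hc
  apply hu
  beta_reduce
  rw [not_not.1 (mt (h1 u) hc), not_not.1 (mt (h2 u) hc)]
  ring

lemma isChain1_sub_mul {H : SimpleGraph V} {f h : V → V → ℤ} (hf : IsChain1 H f)
    (hh : IsChain1 H h) (m : ℤ) : IsChain1 H (fun a b => f a b - m * h a b) := by
  refine ⟨fun u v => ?_, fun u v huv => ?_⟩
  · simp only [hf.1 u v, hh.1 u v]; ring
  · by_contra hc
    apply huv
    beta_reduce
    rw [not_not.1 (mt (hf.2 u v) hc), not_not.1 (mt (hh.2 u v) hc)]
    ring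

lemma chainDiv_nonpos_of_cut {H : SimpleGraph V} (hH : LocFin H) {k h : V → V → ℤ}
    (hk : IsChain1 H k) (hh : IsChain1 H h) {S : Finset V}
    (hS : ∀ u v, h u v ≠ 0 → u ∈ S ∧ v ∈ S) {m : ℤ} (hm : 0 < m)
    (hdiv : ∀ v, chainDiv k v = - (m * chainDiv h v)) {A : Set V} (hfin : A.Finite ∨ Aᶜ.Finite)
    (hkA : ∀ a ∈ A, ∀ b ∉ A, 0 ≤ k b a) (hA : ∀ a ∈ A, 0 ≤ chainDiv h a) :
    ∀ a ∈ A, chainDiv h a ≤ 0 := by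
  rcases hfin with hfin | hfin
  · have h1 := sum_chainDiv_nonneg hH hk hfin.toFinset fun a ha b hb =>
      hkA a (by simpa using ha) b (by simpa using hb)
    simp only [hdiv, Finset.sum_neg_distrib, ← Finset.mul_sum] at h1
    have h2 : ∑ a ∈ hfin.toFinset, chainDiv h a ≤ 0 := by
      by_contra hc
      push Not at hc
      linarith [mul_pos hm hc]
    intro a ha
    exact (Finset.single_le_sum (f := chainDiv h) (fun b hb => hA b (by simpa using hb))
      (by simpa using ha)).trans h2
  · have hneg : ∀ v, chainDiv (fun a b => - k a b) v = m * chainDiv h v := fun v => by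
      have : chainDiv (fun a b => - k a b) v = - chainDiv k v := by
        unfold chainDiv; rw [finsum_neg_distrib]
      rw [this, hdiv, neg_neg]
    have h1 := sum_chainDiv_nonneg hH (h := fun a b => - k a b)
      ⟨fun u v => by simp only [hk.1 u v], fun u v huv => hk.2 u v (by simpa using huv)⟩
      hfin.toFinset fun b hb a ha => by
        have ha' : a ∈ A := by simpa using ha
        have hb' : b ∉ A := by simpa using hb
        rw [← hk.1 b a]
        exact hkA a ha' b hb'
    simp only [hneg, ← Finset.mul_sum] at h1
    have h2 : 0 ≤ ∑ a ∈ hfin.toFinset, chainDiv h a := by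
      by_contra hc
      push Not at hc
      linarith [mul_pos_of_neg_of_neg hc (neg_neg_of_pos hm)]
    have h3 := sum_chainDiv_eq_zero hH hh (S := hfin.toFinset ∪ S) fun u v huv =>
      ⟨Finset.mem_union_right _ (hS u v huv).1, Finset.mem_union_right _ (hS u v huv).2⟩
    rw [← Finset.union_sdiff_self_eq_union, Finset.sum_union Finset.disjoint_sdiff] at h3
    intro a ha
    by_cases haS : a ∈ S
    · have h4 := Finset.single_le_sum (f := chainDiv h) (s := S \ hfin.toFinset)
        (fun b hb => hA b (by simpa using (Finset.mem_sdiff.1 hb).2)) (a := a)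
        (by simp [haS, ha])
      linarith
    · exact (chainDiv_eq_zero_of_notMem hS haS).le

/-- In a graph with one end, a flow agrees on any finite set with a finitely supported flow of no
larger norm. -/
lemma exists_finFlow_extending {H : SimpleGraph V} (hH : LocFin H) (hcut : CutFin H)
    {f : V → V → ℤ} (hf : IsChain1 H f) (hd : ∀ v, chainDiv f v = 0) {M : ℕ} (hM : Bdd f M)
    (U : Finset V) :
    ∃ F, FinFlow H F ∧ Bdd F M ∧ ∀ u ∈ U, ∀ v ∈ U, F u v = f u v := by
  obtain rfl | hpos := Nat.eq_zero_or_pos M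
  · refine ⟨fun _ _ => 0, ⟨⟨by simp, by simp⟩, ⟨∅, by simp⟩, fun v => by simp [chainDiv]⟩,
      fun _ _ => by simp, fun u _ v _ => ?_⟩
    have := hM u v
    simp only [Nat.cast_zero, abs_nonpos_iff] at this
    exact this.symm
  let c : V → V → ℤ := fun a b => if a ∈ U ∧ b ∈ U then f a b else M
  have hfc : ∀ a b, f a b ≤ c a b := fun a b => by
    simp only [c]; split_ifs
    · exact le_rfl
    · exact (abs_le.1 (hM a b)).2
  have hcM : ∀ a b, c a b ≤ M := fun a b => by
    simp only [c]; split_ifs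
    · exact (abs_le.1 (hM a b)).2
    · exact le_rfl
  have h0 : Feasible H c (fun a b => if a ∈ U ∧ b ∈ U then f a b else 0) := by
    refine ⟨⟨fun u v => ?_, fun u v huv => ?_⟩, ⟨U, fun u v huv => ?_⟩, fun a b _ => ?_⟩
    · simp only [and_comm (a := u ∈ U)]
      split_ifs
      · exact hf.1 u v
      · simp
    · exact hf.2 u v (by by_contra hc; simp [hc] at huv)
    · by_contra hc; simp [hc] at huv
    · simp only [c]; split_ifs
      · exact le_rfl
      · positivity
  obtain ⟨h, ⟨hch, hS, hc⟩, hdh⟩ := exists_feasible_flow hH h0 (by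
    rintro h ⟨hch, ⟨S, hS⟩, hc⟩ A hsat hA
    refine chainDiv_nonpos_of_cut hH (k := fun a b => f a b - 1 * h a b)
      (isChain1_sub_mul hf hch 1) hch hS one_pos (fun v => ?_) (hcut A ?_) (fun a ha b hb => ?_) hA
    · rw [chainDiv_sub_mul hH hf hch, hd]; ring
    · refine ((U ∪ S) ×ˢ (U ∪ S)).finite_toSet.subset ?_
      rintro ⟨a, b⟩ ⟨hab, ha, hb⟩
      simp only [Finset.coe_product, Set.mem_prod, Finset.mem_coe, Finset.mem_union]
      have h1 := hsat a ha b hb hab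
      by_cases hU : a ∈ U ∧ b ∈ U
      · exact ⟨Or.inl hU.1, Or.inl hU.2⟩
      · have := hS a b (by rw [h1]; simp only [c, hU, if_false]; positivity)
        exact ⟨Or.inr this.1, Or.inr this.2⟩
    · rw [hf.1 b a, hch.1 b a]
      by_cases hab : H.Adj a b
      · rw [hsat a ha b hb hab]
        linarith [hfc a b]
      · rw [not_not.1 (mt (hf.2 a b) hab), not_not.1 (mt (hch.2 a b) hab)]
        simp)
  refine ⟨h, ⟨hch, hS, hdh⟩, fun a b => ?_, fun a ha b hb => ?_⟩
  · by_cases hab : H.Adj a b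
    · have h1 := (hc a b hab).trans (hcM a b)
      have h2 := (hc b a hab.symm).trans (hcM b a)
      rw [hch.1 b a] at h2
      exact abs_le.2 ⟨by linarith, h1⟩
    · rw [not_not.1 (mt (hch.2 a b) hab)]; simp
  · by_cases hab : H.Adj a b
    · have h1 := hc a b hab
      have h2 := hc b a hab.symm
      rw [hch.1 b a] at h2
      simp only [c, ha, hb, and_self, if_true] at h1 h2
      rw [hf.1 b a] at h2
      linarith
    · rw [not_not.1 (mt (hch.2 a b) hab), not_not.1 (mt (hf.2 a b) hab)]

/-- A finitely supported flow of norm at most `M + 1` splits off one of norm at most one. -/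
lemma FinFlow.exists_split {H : SimpleGraph V} (hH : LocFin H) {f : V → V → ℤ} (hf : FinFlow H f)
    {M : ℕ} (hM : Bdd f (M + 1)) :
    ∃ h, FinFlow H h ∧ Bdd h 1 ∧ FinFlow H (fun a b => f a b - 1 * h a b) ∧
      Bdd (fun a b => f a b - 1 * h a b) M := by
  obtain ⟨hf, ⟨S, hS⟩, hd⟩ := hf
  have hM' : ∀ a b, -((M : ℤ) + 1) ≤ f a b ∧ f a b ≤ M + 1 := fun a b => by
    have := abs_le.1 (hM a b); push_cast at this; exact this
  let c : V → V → ℤ := fun a b => if 0 < f a b then 1 else if f a b = -(M + 1) then -1 else 0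
  have h0 : Feasible H c
      (fun a b => if f a b = M + 1 then 1 else if f a b = -(M + 1) then -1 else 0) := by
    have hz : ∀ u v, (if f u v = M + 1 then (1 : ℤ) else if f u v = -(M + 1) then -1 else 0) ≠ 0 →
        f u v ≠ 0 := fun u v huv h => by
      rw [h, if_neg (by omega), if_neg (by omega)] at huv
      exact huv rfl
    refine ⟨⟨fun u v => ?_, fun u v huv => hf.2 u v (hz u v huv)⟩,
      ⟨S, fun u v huv => hS u v (hz u v huv)⟩, fun a b _ => ?_⟩
    · have := hf.1 u v
      simp only
      split_ifs <;> omega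
    · simp only [c]
      split_ifs <;> omega
  obtain ⟨h, ⟨hch, ⟨S', hS'⟩, hc⟩, hdh⟩ := exists_feasible_flow hH h0 (by
    rintro h ⟨hch, ⟨S', hS'⟩, hc⟩ A hsat hA a ha
    by_cases haS : a ∈ S'
    swap
    · exact (chainDiv_eq_zero_of_notMem hS' haS).le
    refine chainDiv_nonpos_of_cut hH (k := fun a b => f a b - (M + 1) * h a b)
      (isChain1_sub_mul hf hch _) hch hS' (m := M + 1) (by positivity) (fun v => ?_)
      (A := A ∩ ((S ∪ S' : Finset V) : Set V)) (Or.inl ?_) ?_ (fun a ha => hA a ha.1) a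
      ⟨ha, by simp [haS]⟩
    · rw [chainDiv_sub_mul hH hf hch, hd]; ring
    · exact (Finset.finite_toSet _).inter_of_right _
    · rintro a ⟨ha, haS⟩ b hb
      have hz : ∀ a b, ¬ H.Adj a b → 0 ≤ f a b - (M + 1) * h a b := fun a b hab => by
        rw [not_not.1 (mt (hf.2 a b) hab), not_not.1 (mt (hch.2 a b) hab)]; simp
      by_cases hbS : b ∈ S ∪ S'
      · have hbA : b ∉ A := fun h => hb ⟨h, by exact_mod_cast hbS⟩
        by_cases hab : H.Adj a b
        · rw [hf.1 b a, hch.1 b a, hsat a ha b hbA hab]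
          have := hM' a b
          simp only [c]
          split_ifs <;> nlinarith
        · exact hz b a fun h => hab h.symm
      · rw [Finset.mem_union, not_or] at hbS
        rw [not_not.1 (mt (hS b a) fun h => hbS.1 h.1), not_not.1 (mt (hS' b a) fun h => hbS.2 h.1)]
        simp)
  have hb : ∀ a b, |h a b| ≤ 1 ∧ |f a b - 1 * h a b| ≤ M := by
    intro a b
    by_cases hab : H.Adj a b
    · have h1 := hc a b hab
      have h2 := hc b a hab.symm
      have h3 := hM' a b
      rw [hch.1 b a] at h2
      simp only [c, hf.1 b a] at h1 h2
      rw [abs_le, abs_le]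
      split_ifs at h1 h2 <;> omega
    · rw [not_not.1 (mt (hf.2 a b) hab), not_not.1 (mt (hch.2 a b) hab)]; simp
  refine ⟨h, ⟨hch, ⟨S', hS'⟩, hdh⟩, fun a b => by simpa using (hb a b).1,
    ⟨isChain1_sub_mul hf hch 1, ⟨S ∪ S', fun u v huv => ?_⟩, fun v => ?_⟩, fun a b => (hb a b).2⟩
  · by_cases hz : h u v = 0
    · have := hS u v (by simpa [hz] using huv)
      exact ⟨Finset.mem_union_left _ this.1, Finset.mem_union_left _ this.2⟩
    · exact ⟨Finset.mem_union_right _ (hS' u v hz).1, Finset.mem_union_right _ (hS' u v hz).2⟩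
  · rw [chainDiv_sub_mul hH hf hch, hd, hdh]; simp

/-- Local fillings of unit flows give local fillings of all finitely supported flows. -/
lemma FinFlow.exists_local_filling {H H' : SimpleGraph V} (hH : LocFin H) (hH' : LocFin H')
    {U : Finset V} {n : ℕ}
    (hunit : ∀ F, FinFlow H F → Bdd F 1 →
      ∃ g, IsChain2 H' g ∧ Bdd2 g n ∧ ∀ u ∈ U, ∀ v ∈ U, bd2 g u v = F u v) (M : ℕ) :
    ∀ F, FinFlow H F → Bdd F M →
      ∃ g, IsChain2 H' g ∧ Bdd2 g (M * n) ∧ ∀ u ∈ U, ∀ v ∈ U, bd2 g u v = F u v := by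
  induction M with
  | zero =>
    intro F _ hM
    refine ⟨fun _ _ _ => 0, ⟨by simp, by simp, by simp⟩, fun _ _ _ => by simp, fun u _ v _ => ?_⟩
    have := hM u v
    simp only [Nat.cast_zero, abs_nonpos_iff] at this
    simp [bd2, this]
  | succ M ih =>
    intro F hF hM
    obtain ⟨h, hh, hh1, hk, hkM⟩ := hF.exists_split hH hM
    obtain ⟨g, hg, hgn, hgU⟩ := hunit h hh hh1
    obtain ⟨g', hg', hgn', hgU'⟩ := ih _ hk hkM
    refine ⟨_, hg.add hg', fun u v w => ?_, fun u hu v hv => ?_⟩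
    · have h1 := hgn u v w
      have h2 := hgn' u v w
      push_cast at h1 h2 ⊢
      linarith [abs_add_le (g u v w) (g' u v w)]
    · rw [bd2_add hH' hg hg', hgU u hu v hv, hgU' u hu v hv]; ring

lemma CutFin.mono {H H' : SimpleGraph V} (h : H ≤ H') (hc : CutFin H) : CutFin H' :=
  fun A hA => hc A (hA.subset fun _ hp => ⟨h hp.1, hp.2⟩)

lemma ConnAvoiding.symm {G : SimpleGraph V} {K : Set V} {a b : V} (h : ConnAvoiding G K a b) :
    ConnAvoiding G K b a := by
  obtain ⟨p, hp⟩ := h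
  exact ⟨p.reverse, by simpa using hp⟩

lemma ConnAvoiding.trans {G : SimpleGraph V} {K : Set V} {a b d : V} (h : ConnAvoiding G K a b)
    (h' : ConnAvoiding G K b d) : ConnAvoiding G K a d := by
  obtain ⟨p, hp⟩ := h
  obtain ⟨q, hq⟩ := h'
  refine ⟨p.append q, fun v hv => ?_⟩
  rw [SimpleGraph.Walk.mem_support_append_iff] at hv
  exact hv.elim (hp v) (hq v)

lemma ConnAvoiding.refl {G : SimpleGraph V} {K : Set V} {a : V} (h : a ∉ K) :
    ConnAvoiding G K a a :=
  ⟨SimpleGraph.Walk.nil, by simpa using h⟩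

lemma ConnAvoiding.of_adj {G : SimpleGraph V} {K : Set V} {a b : V} (hab : G.Adj a b) (ha : a ∉ K)
    (hb : b ∉ K) : ConnAvoiding G K a b :=
  ⟨hab.toWalk, by simp [ha, hb]⟩

lemma ConnAvoiding.mem_of_mem {G : SimpleGraph V} {K A : Set V} {a b : V}
    (h : ConnAvoiding G K a b) (hA : ∀ x y, G.Adj x y → x ∈ A → y ∉ A → x ∈ K) (ha : a ∈ A) :
    b ∈ A := by
  obtain ⟨p, hp⟩ := h
  induction p with
  | nil => exact ha
  | cons hab q ih =>
    refine ih (by_contra fun hc => hp _ (by simp) (hA _ _ hab ha hc)) fun v hv => hp v ?_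
    simp [hv]

lemma exists_connAvoiding_boundary {G : SimpleGraph V} {K : Set V} {a b : V} (p : G.Walk a b)
    (ha : a ∉ K) (hb : b ∈ K) :
    ∃ x y, x ∉ K ∧ y ∈ K ∧ G.Adj x y ∧ ConnAvoiding G K a x := by
  induction p with
  | nil => exact absurd hb ha
  | @cons u v w huv q ih =>
    by_cases hv : v ∈ K
    · exact ⟨u, v, ha, hv, huv, ConnAvoiding.refl ha⟩
    · obtain ⟨x, y, hx, hy, hxy, hc⟩ := ih hv hb
      exact ⟨x, y, hx, hy, hxy, (ConnAvoiding.of_adj huv ha hv).trans hc⟩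

lemma exists_infinite_component {G : SimpleGraph V} (hG : LocFin G) (hconn : G.Connected)
    {K : Finset V} (hK : K.Nonempty) {B : Set V} (hB : B.Infinite) :
    ∃ b ∈ B, b ∉ K ∧ (Component G (↑K) b).Infinite := by
  choose N hN using hG
  obtain ⟨o, ho⟩ := hK
  have hsub : B \ ↑K ⊆ ⋃ x ∈ K.biUnion N, B ∩ Component G (↑K) x := by
    rintro b ⟨hbB, hbK⟩
    obtain ⟨p⟩ := hconn.preconnected b o
    obtain ⟨x, y, hx, hy, hxy, hc⟩ := exists_connAvoiding_boundary p hbK ho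
    simp only [Set.mem_iUnion]
    exact ⟨x, Finset.mem_biUnion.2 ⟨y, hy, hN y x hxy.symm⟩, hbB, hbK, hc⟩
  obtain ⟨x, hx⟩ : ∃ x, (B ∩ Component G (↑K) x).Infinite := by
    by_contra! hc
    exact (hB.sdiff K.finite_toSet) ((Set.Finite.biUnion (K.biUnion N).finite_toSet
      fun x _ => by simpa using hc x).subset hsub)
  obtain ⟨b, hb, hbK, hbx⟩ := hx.nonempty
  exact ⟨b, hb, hbK, (hx.mono Set.inter_subset_right).mono fun u hu => ⟨hu.1, hu.2.trans hbx.symm⟩⟩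

lemma cutFin_of_not_moreThanOneEnd {G : SimpleGraph V} (hG : LocFin G) (hconn : G.Connected)
    (h : ¬ MoreThanOneEnd G) : CutFin G := by
  intro A hA
  by_contra! hc
  obtain ⟨o⟩ := hconn.nonempty
  let K : Finset V := insert o (hA.toFinset.image Prod.fst ∪ hA.toFinset.image Prod.snd)
  have hK : ∀ x y, G.Adj x y → x ∈ A → y ∉ A → x ∈ (↑K : Set V) := by
    intro x y hxy hx hy
    have : (x, y) ∈ hA.toFinset := by simpa using ⟨hxy, hx, hy⟩
    simp only [K, Finset.coe_insert, Finset.coe_union, Finset.coe_image]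
    exact Or.inr (Or.inl ⟨_, by exact_mod_cast this, rfl⟩)
  obtain ⟨v, hv, hvK, hvi⟩ := exists_infinite_component hG hconn (K := K) (by simp [K])
    (show A.Infinite from hc.1)
  obtain ⟨w, hw, hwK, hwi⟩ := exists_infinite_component hG hconn (K := K) (by simp [K])
    (show Aᶜ.Infinite from hc.2)
  exact h ⟨K, v, w, hvK, hwK, hvi, hwi, fun hvw => hw (hvw.mem_of_mem hK hv)⟩

lemma walkChain_nil {G : SimpleGraph V} (u a b : V) :
    walkChain (SimpleGraph.Walk.nil : G.Walk u u) a b = 0 := by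
  have h : ∀ x y, traversals (SimpleGraph.Walk.nil : G.Walk u u) x y = 0 := fun x y =>
    Nat.eq_zero_of_le_zero (Finset.card_filter_le _ _)
  simp [walkChain, h]

lemma traversals_cons {G : SimpleGraph V} {u v w : V} (h : G.Adj u v) (p : G.Walk v w) (a b : V) :
    traversals (SimpleGraph.Walk.cons h p) a b =
      traversals p a b + if u = a ∧ v = b then 1 else 0 := by
  unfold traversals
  rw [Finset.card_filter, Finset.card_filter, SimpleGraph.Walk.length_cons,
    Finset.sum_range_succ']
  simp only [SimpleGraph.Walk.getVert_cons_succ, SimpleGraph.Walk.getVert_zero]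
  congr

lemma walkChain_cons {G : SimpleGraph V} {u v w : V} (h : G.Adj u v) (p : G.Walk v w) (a b : V) :
    walkChain (SimpleGraph.Walk.cons h p) a b = elem1 u v a b + walkChain p a b := by
  unfold walkChain
  rw [traversals_cons, traversals_cons]
  push_cast
  have h1 : ∀ x y : V, (if u = x ∧ v = y then (1 : ℤ) else 0) = delta u x * delta v y := by
    intro x y
    by_cases hx : u = x <;> by_cases hy : v = y <;> simp [delta, hx, hy]
  rw [h1, h1]
  unfold elem1
  ring

lemma walkChain_append {G : SimpleGraph V} {u v w : V} (p : G.Walk u v) (q : G.Walk v w)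
    (a b : V) : walkChain (p.append q) a b = walkChain p a b + walkChain q a b := by
  induction p with
  | nil => simp [walkChain_nil]
  | cons h p ih => rw [SimpleGraph.Walk.cons_append, walkChain_cons, walkChain_cons, ih, add_assoc]

lemma walkChain_reverse {G : SimpleGraph V} {u v : V} (p : G.Walk u v) (a b : V) :
    walkChain p.reverse a b = - walkChain p a b := by
  induction p with
  | nil => simp [walkChain_nil]
  | cons h p ih =>
    rw [SimpleGraph.Walk.reverse_cons, walkChain_append, walkChain_cons, walkChain_cons, ih,
      walkChain_nil, elem1_comm]
    ring

lemma walkChain_antisymm {G : SimpleGraph V} {u v : V} (p : G.Walk u v) (a b : V) :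
    walkChain p a b = - walkChain p b a := by
  unfold walkChain; ring

lemma adj_of_walkChain_ne_zero {G : SimpleGraph V} {u v a b : V} {p : G.Walk u v}
    (h : walkChain p a b ≠ 0) : G.Adj a b ∧ a ∈ p.support ∧ b ∈ p.support := by
  induction p with
  | nil => exact absurd (walkChain_nil _ _ _) h
  | @cons u v w huv q ih =>
    rw [walkChain_cons] at h
    by_cases h0 : walkChain q a b = 0
    · rw [h0, add_zero] at h
      have hv := q.start_mem_support
      obtain ⟨-, ⟨rfl, rfl⟩ | ⟨rfl, rfl⟩⟩ := elem1_ne_zero h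
      · exact ⟨huv, by simp, by simp [hv]⟩
      · exact ⟨huv.symm, by simp [hv], by simp⟩
    · obtain ⟨h1, h2, h3⟩ := ih h0
      exact ⟨h1, by simp [h2], by simp [h3]⟩

lemma isChain1_walkChain {G : SimpleGraph V} {u v : V} (p : G.Walk u v) :
    IsChain1 G (walkChain p) :=
  ⟨walkChain_antisymm p, fun _ _ h => (adj_of_walkChain_ne_zero h).1⟩

lemma OnWalk.mem_support {G : SimpleGraph V} {u v a b : V} {p : G.Walk u v} (h : OnWalk p a b) :
    a ∈ p.support := by
  obtain ⟨i, -, ⟨rfl, -⟩ | ⟨-, rfl⟩⟩ := h <;> exact p.getVert_mem_support _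

lemma chainDiv_add_of_support {f h : V → V → ℤ} {v : V} {S T : Finset V}
    (hf : ∀ u, f u v ≠ 0 → u ∈ S) (hh : ∀ u, h u v ≠ 0 → u ∈ T) :
    chainDiv (fun a b => f a b + h a b) v = chainDiv f v + chainDiv h v := by
  unfold chainDiv
  exact finsum_add_distrib (S.finite_toSet.subset hf) (T.finite_toSet.subset hh)

lemma chainDiv_walkChain {G : SimpleGraph V} {u w : V} (p : G.Walk u w) (x : V) :
    chainDiv (walkChain p) x = delta w x - delta u x := by
  induction p with
  | nil => simp [chainDiv, walkChain_nil]
  | @cons u v w huv q ih =>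
    have h1 : walkChain (SimpleGraph.Walk.cons huv q) = fun a b => elem1 u v a b + walkChain q a b := by
      funext a b; exact walkChain_cons huv q a b
    rw [h1, chainDiv_add_of_support (S := {u, v}) (T := q.support.toFinset) (fun y hy => ?_)
      (fun y hy => by simpa using (adj_of_walkChain_ne_zero hy).2.1), ih, chainDiv_elem1]
    · ring
    · obtain ⟨-, ⟨h1, -⟩ | ⟨-, h2⟩⟩ := elem1_ne_zero hy
      · simp [h1]
      · simp [h2]

lemma dist_le_of_mem_support {G : SimpleGraph V} {u v x : V} {p : G.Walk u v} (hx : x ∈ p.support) :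
    G.dist u x ≤ p.length :=
  (SimpleGraph.dist_le (p.takeUntil x hx)).trans (p.length_takeUntil_le_length hx)

/-- The cone with apex `o` over a walk. -/
noncomputable def cone {G : SimpleGraph V} (o : V) : {u v : V} → G.Walk u v → V → V → V → ℤ
  | _, _, .nil => fun _ _ _ => 0
  | u, _, .cons (v := v) _ p => fun a b d => elem2 o u v a b d + cone o p a b d

lemma cone_ne_zero {G : SimpleGraph V} {o u v a b d : V} {p : G.Walk u v}
    (h : cone o p a b d ≠ 0) :
    (a = o ∨ a ∈ p.support) ∧ (b = o ∨ b ∈ p.support) ∧ (d = o ∨ d ∈ p.support) := by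
  induction p with
  | nil => exact absurd rfl h
  | @cons u v w huv q ih =>
    by_cases h0 : cone o q a b d = 0
    · have h1 : elem2 o u v a b d ≠ 0 := by simpa [cone, h0] using h
      have hv := q.start_mem_support
      obtain ⟨-, -, -, ha, hb, hd⟩ := elem2_ne_zero h1
      refine ⟨?_, ?_, ?_⟩
      · rcases ha with rfl | rfl | rfl <;> simp [hv]
      · rcases hb with rfl | rfl | rfl <;> simp [hv]
      · rcases hd with rfl | rfl | rfl <;> simp [hv]
    · obtain ⟨h1, h2, h3⟩ := ih h0
      simp only [SimpleGraph.Walk.support_cons, List.mem_cons]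
      tauto

lemma abs_cone_le {G : SimpleGraph V} (o : V) {u v : V} (p : G.Walk u v) (a b d : V) :
    |cone o p a b d| ≤ ((3 * p.length : ℕ) : ℤ) := by
  induction p with
  | nil => simp [cone]
  | @cons u v w huv q ih =>
    have := abs_add_le (elem2 o u v a b d) (cone o q a b d)
    have := abs_elem2_le o u v a b d
    rw [SimpleGraph.Walk.length_cons]
    push_cast at *
    simp only [cone]
    linarith

lemma bd2_cone {G : SimpleGraph V} (o : V) {u v : V} (p : G.Walk u v) (a b : V) :
    bd2 (cone o p) a b = walkChain p a b + elem1 o u a b - elem1 o v a b := by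
  induction p with
  | nil => simp [bd2, cone, walkChain_nil]
  | @cons u v w huv q ih =>
    have h1 : bd2 (cone o (SimpleGraph.Walk.cons huv q)) a b =
        bd2 (elem2 o u v) a b + bd2 (cone o q) a b := by
      unfold bd2
      refine finsum_add_distrib (Set.Finite.subset ({o, u, v} : Finset V).finite_toSet ?_)
        (Set.Finite.subset (insert o q.support.toFinset).finite_toSet ?_)
      · intro d hd
        simpa using (elem2_ne_zero hd).2.2.2.2.2
      · intro d hd
        simpa using (cone_ne_zero hd).2.2
    rw [h1, ih, bd2_elem2, walkChain_cons, elem1_comm v o]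
    ring

lemma isChain2_cone {G : SimpleGraph V} {s : ℕ} (hs : 1 ≤ s) (o : V) {u v : V} (p : G.Walk u v)
    (h : ∀ x ∈ p.support, G.dist o x ≤ s) : IsChain2 (rips G s) (cone o p) := by
  induction p with
  | nil => exact ⟨by simp [cone], by simp [cone], by simp [cone]⟩
  | @cons u v w huv q ih =>
    refine IsChain2.add (isChain2_elem2 (fun hne => ?_) (fun _ => le_rips G hs huv) fun hne => ?_)
      (ih fun x hx => h x (by simp [hx]))
    · exact rips_adj.2 ⟨hne, h u (by simp)⟩
    · exact rips_adj.2 ⟨hne, h v (by simp)⟩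

/-- Finitely supported flows are boundaries in some Rips graph. -/
lemma FinFlow.exists_bdOf {G : SimpleGraph V} (hconn : G.Connected) {F : V → V → ℤ}
    (hF : FinFlow G F) {M : ℕ} (hM : Bdd F M) : ∃ s, BdOf (rips G s) (3 * M) F := by
  obtain ⟨o⟩ := hconn.nonempty
  obtain ⟨hF, ⟨S, hS⟩, hd⟩ := hF
  have hself : ∀ x, F x x = 0 := fun x => by have := hF.1 x x; omega
  let R := S.sup fun x => G.dist o x
  have hR : ∀ x, x = o ∨ x ∈ S → G.dist o x ≤ R := by
    rintro x (rfl | hx)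
    · simp
    · exact Finset.le_sup (f := fun x => G.dist o x) hx
  let g : V → V → V → ℤ := fun a b d => delta o a * F b d + delta o b * F d a + delta o d * F a b
  have hg : ∀ a b d, g a b d ≠ 0 → (a = o ∨ a ∈ S) ∧ (b = o ∨ b ∈ S) ∧ (d = o ∨ d ∈ S) := by
    have key : ∀ a b d, delta o a * F b d ≠ 0 → a = o ∧ b ∈ S ∧ d ∈ S := by
      intro a b d h
      refine ⟨?_, hS b d (right_ne_zero_of_mul h)⟩
      by_contra hc
      exact left_ne_zero_of_mul h (by simp [delta, Ne.symm hc])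
    intro a b d h
    by_cases h1 : delta o a * F b d = 0
    · by_cases h2 : delta o b * F d a = 0
      · have := key d a b (by simpa [g, h1, h2] using h)
        tauto
      · have := key b d a h2
        tauto
    · have := key a b d h1
      tauto
  refine ⟨2 * R, g, ⟨fun a b d => ?_, fun a b d => ?_, fun a b d h => ?_⟩, fun a b d => ?_, ?_⟩
  · simp only [g]
    rw [hF.1 b d, hF.1 d a, hF.1 a b]; ring
  · simp only [g]
    rw [hF.1 b d, hF.1 d a, hF.1 a b]; ring
  · obtain ⟨ha, hb, hd'⟩ := hg a b d h
    have hdist : ∀ x y, (x = o ∨ x ∈ S) → (y = o ∨ y ∈ S) → G.dist x y ≤ 2 * R := by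
      intro x y hx hy
      have h1 := hR x hx
      have h2 := hR y hy
      have h3 := hconn.dist_triangle (u := x) (v := o) (w := y)
      rw [G.dist_comm (u := x) (v := o)] at h3
      omega
    refine ⟨rips_adj.2 ⟨?_, hdist _ _ ha hb⟩, rips_adj.2 ⟨?_, hdist _ _ hb hd'⟩,
      rips_adj.2 ⟨?_, hdist _ _ ha hd'⟩⟩
    · rintro rfl
      apply h; simp only [g, hself]; rw [hF.1 a d]; ring
    · rintro rfl
      apply h; simp only [g, hself]; rw [hF.1 a b]; ring
    · rintro rfl
      apply h; simp only [g, hself]; rw [hF.1 a b]; ring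
  · have h1 : ∀ x y z, |delta o x * F y z| ≤ M := fun x y z => by
      rw [abs_mul]
      calc |delta o x| * |F y z| ≤ 1 * M :=
            mul_le_mul (abs_delta_le _ _) (hM y z) (abs_nonneg _) zero_le_one
        _ = M := one_mul _
    have h2 := abs_add_le (delta o a * F b d + delta o b * F d a) (delta o d * F a b)
    have h3 := abs_add_le (delta o a * F b d) (delta o b * F d a)
    push_cast
    simp only [g]
    linarith [h1 a b d, h1 b d a, h1 d a b]
  · funext a b
    have e1 : ∑ d ∈ insert o S, F b d = 0 := by
      have := hd b
      unfold chainDiv at this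
      rw [finsum_eq_sum_of_mem (insert o S) fun x hx =>
        Finset.mem_insert_of_mem (hS x b hx).1] at this
      rw [Finset.sum_congr rfl fun d _ => hF.1 b d, Finset.sum_neg_distrib, this, neg_zero]
    have e2 : ∑ d ∈ insert o S, F d a = 0 := by
      have := hd a
      unfold chainDiv at this
      rwa [finsum_eq_sum_of_mem (insert o S) fun x hx =>
        Finset.mem_insert_of_mem (hS x a hx).1] at this
    have e3 : ∑ d ∈ insert o S, delta o d = 1 := by
      rw [Finset.sum_eq_single o]
      · simp [delta]
      · intro d _ hd; simp [delta, hd.symm]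
      · intro h; exact absurd (Finset.mem_insert_self o S) h
    unfold bd2
    rw [finsum_eq_sum_of_mem (insert o S) fun d hd => by simpa using (hg a b d hd).2.2]
    simp only [g, Finset.sum_add_distrib, ← Finset.mul_sum, ← Finset.sum_mul]
    rw [e1, e2, e3]; ring

lemma exists_finset_circuits {G : SimpleGraph V} (hG : LocFin G) (hconn : G.Connected)
    (htrans : VertexTransitive G) (r : ℕ) :
    ∃ N, ∀ a, ∃ S : Finset (Circuit G), S.card ≤ N ∧
      ∀ c : Circuit G, c.2.length ≤ r → G.dist a c.1 ≤ r → c ∈ S := by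
  obtain ⟨N, hN⟩ := exists_card_ballF_le hG hconn htrans (2 * r)
  refine ⟨(r + 1) * N ^ (r + 1), fun a => ?_⟩
  let e : Circuit G → ℕ × (Fin (r + 1) → V) := fun c => (c.2.length, fun i => c.2.getVert i)
  let s : Set (Circuit G) := {c | c.2.length ≤ r ∧ G.dist a c.1 ≤ r}
  let T : Finset (ℕ × (Fin (r + 1) → V)) :=
    Finset.range (r + 1) ×ˢ Fintype.piFinset fun _ => ballF G a (2 * r)
  have hmaps : Set.MapsTo e s T := by
    rintro c ⟨h1, h2⟩
    simp only [e, T, Finset.coe_product, Set.mem_prod, Finset.mem_coe, Finset.mem_range,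
      Fintype.mem_piFinset]
    refine ⟨by omega, fun i => (mem_ballF hG hconn).2 ?_⟩
    have h3 := dist_le_of_mem_support (c.2.getVert_mem_support i)
    have h4 := hconn.dist_triangle (u := a) (v := c.1) (w := c.2.getVert i)
    omega
  have hinj : Set.InjOn e s := by
    rintro ⟨u, p⟩ hp ⟨v, q⟩ hq h
    simp only [e, Prod.mk.injEq] at h
    obtain ⟨h1, h2⟩ := h
    have h3 := congrFun h2 0
    simp only [Fin.val_zero, SimpleGraph.Walk.getVert_zero] at h3
    subst h3
    congr 1
    refine SimpleGraph.Walk.ext_getVert_le_length h1 fun k hk => ?_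
    exact congrFun h2 ⟨k, by have := hp.1; simp only at this; omega⟩
  have hfin : s.Finite := Set.Finite.of_injOn hmaps hinj T.finite_toSet
  refine ⟨hfin.toFinset, ?_, fun c h1 h2 => by simpa using ⟨h1, h2⟩⟩
  calc hfin.toFinset.card ≤ T.card := Finset.card_le_card_of_injOn e (by simpa using hmaps)
        (by simpa using hinj)
    _ ≤ (r + 1) * N ^ (r + 1) := by
        simp only [T, Finset.card_product, Finset.card_range, Fintype.card_piFinset_const]
        gcongr
        exact hN a

lemma isChain1_circSum {G : SimpleGraph V} (g : Circuit G → ℤ) : IsChain1 G (circSum G g) := by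
  refine ⟨fun u v => ?_, fun u v h => ?_⟩
  · unfold circSum
    rw [← finsum_neg_distrib]
    exact finsum_congr fun c => by rw [walkChain_antisymm, mul_neg]
  · obtain ⟨c, hc⟩ := exists_ne_zero_of_finsum h
    exact (adj_of_walkChain_ne_zero (right_ne_zero_of_mul hc)).1

/-- Bounded sums of short circuits are boundaries in the Rips graph. -/
lemma exists_bdOf_of_mem_Cr {G : SimpleGraph V} (hG : LocFin G) (hconn : G.Connected)
    (htrans : VertexTransitive G) {r s : ℕ} (hs : 1 ≤ s) (hrs : r ≤ s) {f : V → V → ℤ}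
    (hf : f ∈ Cr G r) : IsChain1 G f ∧ ∃ C, BdOf (rips G s) C f := by
  obtain ⟨g, ⟨C, hC⟩, hlen, -, rfl⟩ := hf
  obtain ⟨N, hN⟩ := exists_finset_circuits hG hconn htrans r
  choose S hS hS' using hN
  obtain ⟨D, hD⟩ := exists_degBdd_rips hG hconn htrans s
  have hloc : ∀ (c : Circuit G) a b d, g c * cone c.1 c.2 a b d ≠ 0 → c ∈ S a := by
    intro c a b d h
    have h1 := hlen c (left_ne_zero_of_mul h)
    refine hS' a c h1 ?_
    rw [G.dist_comm]
    rcases (cone_ne_zero (right_ne_zero_of_mul h)).1 with h2 | h2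
    · rw [h2]; simp
    · exact (dist_le_of_mem_support h2).trans h1
  obtain ⟨h1, h2⟩ := isChain2_finsum hD.locFin g (fun c => cone c.1 c.2) S hloc fun c hc =>
    isChain2_cone hs c.1 c.2 fun x hx => (dist_le_of_mem_support hx).trans ((hlen c hc).trans hrs)
  refine ⟨isChain1_circSum g, N * (C * (3 * r)), _, h1, fun a b d => ?_, ?_⟩
  · refine abs_finsum_le (S a) (fun c => hloc c a b d) (hS a) fun c => ?_
    by_cases hc : g c = 0
    · rw [hc]; simp; positivity
    · rw [abs_mul, Nat.cast_mul]
      refine mul_le_mul (hC c) ((abs_cone_le _ _ _ _ _).trans ?_) (abs_nonneg _) (by positivity)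
      have := hlen c hc
      exact_mod_cast Nat.mul_le_mul_left 3 this
  · funext a b
    rw [h2]
    refine finsum_congr fun c => ?_
    rw [bd2_cone]; ring

lemma finsum_elem1_eq [LinearOrder V] {F : V → V → ℤ} (hF : ∀ u v, F u v = - F v u) (a b : V) :
    ∑ᶠ i : V × V, (if i.1 < i.2 then F i.1 i.2 else 0) * elem1 i.1 i.2 a b = F a b := by
  have hself : ∀ x, F x x = 0 := fun x => by have := hF x x; omega
  rw [finsum_eq_sum_of_mem {(a, b), (b, a)}]
  · by_cases hab : a = b
    · subst hab; simp [hself]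
    · rw [Finset.sum_pair (by simp [hab])]
      have e1 : elem1 a b a b = 1 := by simp [elem1, delta, hab]
      have e2 : elem1 b a a b = -1 := by rw [elem1_comm, e1]
      simp only [e1, e2]
      rcases lt_trichotomy a b with h | h | h
      · simp [h, h.not_gt]
      · exact absurd h hab
      · simp [h, h.not_gt, hF a b]
  · rintro ⟨x, y⟩ h
    obtain ⟨-, ⟨rfl, rfl⟩ | ⟨rfl, rfl⟩⟩ := elem1_ne_zero (right_ne_zero_of_mul h) <;> simp

lemma BdOf.sub {H : SimpleGraph V} (hH : LocFin H) {C C' : ℕ} {f f' : V → V → ℤ}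
    (hf : BdOf H C f) (hf' : BdOf H C' f') : BdOf H (C + C') (fun a b => f a b - f' a b) := by
  obtain ⟨g, hg, hb, rfl⟩ := hf
  obtain ⟨g', hg', hb', rfl⟩ := hf'
  refine ⟨_, hg.add hg'.neg, fun u v w => ?_, ?_⟩
  · push_cast
    have := abs_add_le (g u v w) (- g' u v w)
    rw [abs_neg] at this
    linarith [hb u v w, hb' u v w]
  · funext a b
    rw [bd2_add hH hg hg'.neg, bd2_neg]; ring

/-- Each flow of the Rips graph is homologous to a flow of the graph. -/
lemma exists_bdOf_rips {G : SimpleGraph V} (hG : LocFin G) (hconn : G.Connected)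
    (htrans : VertexTransitive G) {s : ℕ} (hs : 1 ≤ s)
    (h : ∀ f ∈ Zsuf1 G, ∃ C, BdOf (rips G s) C f) {F : V → V → ℤ} (hF : F ∈ Zsuf1 (rips G s)) :
    ∃ C, BdOf (rips G s) C F := by
  let _ : LinearOrder V := linearOrderOfSTO WellOrderingRel
  obtain ⟨hF, ⟨M, hM⟩, hd⟩ := hF
  choose p hp using fun u v => hconn.exists_walk_length_eq_dist u v
  obtain ⟨N, hN⟩ := exists_card_ballF_le hG hconn htrans s
  obtain ⟨N', hN'⟩ := exists_card_ballF_le hG hconn htrans (2 * s)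
  obtain ⟨D, hD⟩ := exists_degBdd_rips hG hconn htrans s
  let k : V × V → ℤ := fun i => if i.1 < i.2 then F i.1 i.2 else 0
  let S : V → Finset (V × V) := fun a => ballF G a s ×ˢ ballF G a (2 * s)
  have hk : ∀ i, k i ≠ 0 → G.dist i.1 i.2 ≤ s := by
    intro i hi
    have : F i.1 i.2 ≠ 0 := fun h0 => hi (by simp [k, h0])
    exact (rips_adj.1 (hF.2 _ _ this)).2
  have hsupp : ∀ i : V × V, k i ≠ 0 → ∀ x ∈ (p i.1 i.2).support, G.dist i.1 x ≤ s :=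
    fun i hi x hx => (dist_le_of_mem_support hx).trans ((hp _ _).le.trans (hk i hi))
  have hmem : ∀ i, k i ≠ 0 → ∀ a, G.dist i.1 a ≤ s → i ∈ S a := by
    intro i hi a ha
    rw [G.dist_comm] at ha
    refine Finset.mem_product.2 ⟨(mem_ballF hG hconn).2 ha, (mem_ballF hG hconn).2 ?_⟩
    have := hconn.dist_triangle (u := a) (v := i.1) (w := i.2)
    have := hk i hi
    omega
  have hloc : ∀ (i : V × V) a b d, k i * cone i.1 (p i.1 i.2) a b d ≠ 0 → i ∈ S a := by
    intro i a b d hi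
    have hki := left_ne_zero_of_mul hi
    refine hmem i hki a ?_
    rcases (cone_ne_zero (right_ne_zero_of_mul hi)).1 with h2 | h2
    · rw [h2]; simp
    · exact hsupp i hki a h2
  obtain ⟨h1, h2⟩ := isChain2_finsum hD.locFin k (fun i => cone i.1 (p i.1 i.2)) S hloc fun i hi =>
    isChain2_cone hs i.1 _ (hsupp i hi)
  set g : V → V → V → ℤ := fun a b d => ∑ᶠ i, k i * cone i.1 (p i.1 i.2) a b d with hg
  have hgB : Bdd2 g (N * N' * (M * (3 * s))) := fun a b d => by
    refine abs_finsum_le (S a) (fun i => hloc i a b d) ?_ fun i => ?_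
    · rw [Finset.card_product]
      exact Nat.mul_le_mul (hN a) (hN' a)
    · by_cases hi : k i = 0
      · rw [hi]; simp; positivity
      · rw [abs_mul, Nat.cast_mul]
        refine mul_le_mul ?_ ((abs_cone_le _ _ _ _ _).trans ?_) (abs_nonneg _) (by positivity)
        · simp only [k]; split_ifs
          · exact hM _ _
          · simp
        · rw [hp]; exact_mod_cast Nat.mul_le_mul_left 3 (hk i hi)
  have hfin1 : ∀ a b, ∀ i : V × V, k i * walkChain (p i.1 i.2) a b ≠ 0 → i ∈ S a := by
    intro a b i hi
    have hki := left_ne_zero_of_mul hi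
    exact hmem i hki a (hsupp i hki a (adj_of_walkChain_ne_zero (right_ne_zero_of_mul hi)).2.1)
  have hfin2 : ∀ a b, ∀ i : V × V, k i * elem1 i.1 i.2 a b ≠ 0 → i ∈ S a := by
    intro a b i hi
    have hki := left_ne_zero_of_mul hi
    refine hmem i hki a (hsupp i hki a ?_)
    obtain ⟨-, ⟨h1, -⟩ | ⟨-, h2⟩⟩ := elem1_ne_zero (right_ne_zero_of_mul hi)
    · rw [← h1]; simp
    · rw [← h2]; simp
  have hsum : ∀ a b, F a b - (-1) * bd2 g a b = ∑ᶠ i, k i * walkChain (p i.1 i.2) a b := by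
    intro a b
    have e1 : ∀ i : V × V, k i * bd2 (cone i.1 (p i.1 i.2)) a b =
        k i * walkChain (p i.1 i.2) a b - k i * elem1 i.1 i.2 a b := fun i => by
      rw [bd2_cone, elem1_self]; ring
    rw [h2, finsum_congr e1, finsum_sub_distrib ((S a).finite_toSet.subset (hfin1 a b))
      ((S a).finite_toSet.subset (hfin2 a b)), finsum_elem1_eq hF.1]
    ring
  have hZ : (fun a b => F a b - (-1) * bd2 g a b) ∈ Zsuf1 G := by
    refine ⟨⟨(isChain1_sub_mul hF (isChain1_bd2 h1) (-1)).1, fun u v huv => ?_⟩,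
      ⟨M + D * (N * N' * (M * (3 * s))), fun u v => ?_⟩, fun v => ?_⟩
    · beta_reduce at huv
      rw [hsum] at huv
      obtain ⟨i, hi⟩ := exists_ne_zero_of_finsum huv
      exact (adj_of_walkChain_ne_zero (right_ne_zero_of_mul hi)).1
    · have e1 := hM u v
      have e2 := bdd_bd2 hD h1 hgB u v
      have e3 := abs_add_le (F u v) (bd2 g u v)
      rw [Nat.cast_add]
      simp only [neg_mul, one_mul, sub_neg_eq_add]
      linarith
    · rw [chainDiv_sub_mul hD.locFin hF (isChain1_bd2 h1), hd, chainDiv_bd2 hD.locFin h1]; ring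
  obtain ⟨C, hC⟩ := h _ hZ
  refine ⟨C + N * N' * (M * (3 * s)), ?_⟩
  convert hC.sub hD.locFin ⟨g, h1, hgB, rfl⟩ using 3
  ring

/-- A locally finite bounded family of short circuits sums up to an element of `Cr`. -/
lemma mem_Cr_of_family {ι : Type} {G : SimpleGraph V} {r C N : ℕ} (k : ι → ℤ) (c : ι → Circuit G)
    (hlen : ∀ i, k i ≠ 0 → (c i).2.length ≤ r) (hC : ∀ i, |k i| ≤ (C : ℤ))
    (T : V → Finset ι) (hN : ∀ a, (T a).card ≤ N)
    (hT : ∀ i, k i ≠ 0 → ∀ a ∈ (c i).2.support, i ∈ T a) :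
    (fun a b => ∑ᶠ i, k i * walkChain (c i).2 a b) ∈ Cr G r := by
  let g : Circuit G → ℤ := fun d => ∑ᶠ i, if c i = d then k i else 0
  have hg : ∀ d, g d ≠ 0 → ∃ i, c i = d ∧ k i ≠ 0 := by
    intro d hd
    obtain ⟨i, hi⟩ := exists_ne_zero_of_finsum hd
    refine ⟨i, ?_, ?_⟩
    · by_contra h; simp [h] at hi
    · rintro h; simp [h] at hi
  have hfib : ∀ (d : Circuit G) i, (if c i = d then k i else 0) ≠ 0 → i ∈ T d.1 := by
    intro d i hi
    by_cases h : c i = d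
    · subst h
      rw [if_pos rfl] at hi
      exact hT i hi _ (by simp)
    · simp [h] at hi
  refine ⟨g, ⟨N * C, fun d => ?_⟩, fun d hd => ?_, fun a b => ?_, ?_⟩
  · refine abs_finsum_le (T d.1) (hfib d) (hN _) fun i => ?_
    split_ifs
    · exact hC i
    · simp
  · obtain ⟨i, rfl, hi⟩ := hg d hd
    exact hlen i hi
  · refine ((T a).image c).finite_toSet.subset ?_
    rintro d ⟨hd, hon⟩
    obtain ⟨i, rfl, hi⟩ := hg d hd
    exact Finset.mem_coe.2 (Finset.mem_image_of_mem c (hT i hi a hon.mem_support))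
  · funext a b
    unfold circSum
    have h1 : ∀ d : Circuit G, g d * walkChain d.2 a b =
        ∑ᶠ i, (if c i = d then k i else 0) * walkChain d.2 a b := by
      intro d
      simp only [g]
      rw [finsum_eq_sum_of_mem (T d.1) (hfib d), finsum_eq_sum_of_mem (T d.1)
        fun i hi => hfib d i (left_ne_zero_of_mul hi), Finset.sum_mul]
    rw [finsum_congr h1, finsum_swap ((T a).image c) (T a)]
    · refine finsum_congr fun i => ?_
      rw [finsum_eq_single _ (c i)]
      · simp
      · intro d hd
        simp [hd.symm]
    · intro d i hi
      have h2 := adj_of_walkChain_ne_zero (right_ne_zero_of_mul hi)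
      have h3 := left_ne_zero_of_mul hi
      have h4 : c i = d := by by_contra h; simp [h] at h3
      subst h4
      rw [if_pos rfl] at h3
      have := hT i h3 a h2.2.1
      exact ⟨Finset.mem_image_of_mem c this, this⟩

/-- Summation over ordered triangles against a function of the edges. -/
lemma sum_triangles [LinearOrder V] {H : SimpleGraph V} {g : V → V → V → ℤ} (hg : IsChain2 H g)
    (w : V → V → ℤ) (Q : Finset V) :
    ∑ x ∈ Q, ∑ y ∈ Q, ∑ z ∈ Q,
        (if x < y ∧ y < z then g x y z else 0) * (w x y + w y z - w x z) =
      ∑ x ∈ Q, ∑ y ∈ Q, ∑ z ∈ Q, (if x < y then w x y else 0) * g x y z := by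
  have hyy : ∀ x y, g x y y = 0 := fun x y => by have := hg.2.1 x y y; omega
  have hxx : ∀ x y, g x y x = 0 := fun x y => by
    have h1 := hg.1 x y x
    have h2 := hg.2.1 y x x
    have h3 := hyy y x
    omega
  have hsplit : ∀ x y z, (if x < y then w x y else 0) * g x y z =
      (if x < y ∧ y < z then w x y * g x y z else 0) -
      (if x < z ∧ z < y then w x y * g x z y else 0) +
      (if z < x ∧ x < y then w x y * g z x y else 0) := by
    intro x y z
    have e1 := hg.2.1 x y z
    have e2 : g x y z = g z x y := by rw [hg.2.1 x y z, hg.1 x z y, neg_neg]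
    by_cases hxy : x < y
    · rcases lt_trichotomy x z with hxz | rfl | hxz
      · rcases lt_trichotomy y z with hyz | rfl | hyz
        · simp [hxy, hyz, hxz, hxz.not_gt, hyz.not_gt]
        · simp [hyy, hxy.not_gt]
        · simp [hxy, hyz, hxz, hxz.not_gt, hyz.not_gt, e1]
      · simp [hxx]
      · simp [hxy, hxz, hxz.not_gt, (hxz.trans hxy).not_gt, e2]
    · have h1 : ¬ (x < z ∧ z < y) := fun h => hxy (h.1.trans h.2)
      simp [hxy, h1]
  simp only [hsplit, Finset.sum_add_distrib, Finset.sum_sub_distrib]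
  have r1 : ∑ x ∈ Q, ∑ y ∈ Q, ∑ z ∈ Q, (if x < z ∧ z < y then w x y * g x z y else 0) =
      ∑ x ∈ Q, ∑ y ∈ Q, ∑ z ∈ Q, (if x < y ∧ y < z then w x z * g x y z else 0) :=
    Finset.sum_congr rfl fun x _ => Finset.sum_comm
  have r2 : ∑ x ∈ Q, ∑ y ∈ Q, ∑ z ∈ Q, (if z < x ∧ x < y then w x y * g z x y else 0) =
      ∑ x ∈ Q, ∑ y ∈ Q, ∑ z ∈ Q, (if x < y ∧ y < z then w y z * g x y z else 0) := by
    rw [Finset.sum_congr rfl fun x _ => Finset.sum_comm, Finset.sum_comm]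
  rw [r1, r2, ← Finset.sum_sub_distrib, ← Finset.sum_add_distrib]
  refine Finset.sum_congr rfl fun x _ => ?_
  rw [← Finset.sum_sub_distrib, ← Finset.sum_add_distrib]
  refine Finset.sum_congr rfl fun y _ => ?_
  rw [← Finset.sum_sub_distrib, ← Finset.sum_add_distrib]
  refine Finset.sum_congr rfl fun z _ => ?_
  split_ifs <;> ring

lemma walkChain_of_length_eq_one {G : SimpleGraph V} {x y : V} {p : G.Walk x y}
    (hp : p.length = 1) (a b : V) : walkChain p a b = elem1 x y a b := by
  cases p with
  | nil => simp at hp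
  | cons h q =>
    cases q with
    | nil => rw [walkChain_cons, walkChain_nil, add_zero]
    | cons h' q' => simp at hp

/-- Boundaries in the Rips graph are bounded sums of short circuits. -/
lemma mem_Cr_of_bdOf {G : SimpleGraph V} (hG : LocFin G) (hconn : G.Connected)
    (htrans : VertexTransitive G) {s C : ℕ} {f : V → V → ℤ} (hf : IsChain1 G f)
    (h : BdOf (rips G s) C f) : f ∈ Cr G (3 * s) := by
  let _ : LinearOrder V := linearOrderOfSTO WellOrderingRel
  obtain ⟨g, hg, hgC, hgf⟩ := h
  choose p hp using fun u v => hconn.exists_walk_length_eq_dist u v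
  obtain ⟨N, hN⟩ := exists_card_ballF_le hG hconn htrans (4 * s)
  have hball : ∀ {x y : V} {R : ℕ}, y ∈ ballF G x R ↔ G.dist x y ≤ R := mem_ballF hG hconn
  let Q : V → Finset V := fun a => ballF G a (4 * s)
  let k : V × V × V → ℤ := fun t => if t.1 < t.2.1 ∧ t.2.1 < t.2.2 then g t.1 t.2.1 t.2.2 else 0
  let c : V × V × V → Circuit G := fun t =>
    ⟨t.1, (p t.1 t.2.1).append ((p t.2.1 t.2.2).append (p t.1 t.2.2).reverse)⟩
  have hdist : ∀ x y z, g x y z ≠ 0 → G.dist x y ≤ s ∧ G.dist y z ≤ s ∧ G.dist x z ≤ s := by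
    intro x y z hne
    obtain ⟨h1, h2, h3⟩ := hg.2.2 x y z hne
    exact ⟨(rips_adj.1 h1).2, (rips_adj.1 h2).2, (rips_adj.1 h3).2⟩
  have hk : ∀ t, k t ≠ 0 → g t.1 t.2.1 t.2.2 ≠ 0 := fun t ht h0 => ht (by simp [k, h0])
  have hlen : ∀ t, k t ≠ 0 → (c t).2.length ≤ 3 * s := by
    intro t ht
    obtain ⟨h1, h2, h3⟩ := hdist _ _ _ (hk t ht)
    simp only [c, SimpleGraph.Walk.length_append, SimpleGraph.Walk.length_reverse, hp]
    omega
  have hT : ∀ t, k t ≠ 0 → ∀ a ∈ (c t).2.support, t ∈ Q a ×ˢ Q a ×ˢ Q a := by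
    intro t ht a ha
    have h0 := (dist_le_of_mem_support ha).trans (hlen t ht)
    obtain ⟨h1, h2, h3⟩ := hdist _ _ _ (hk t ht)
    change G.dist t.1 a ≤ _ at h0
    rw [G.dist_comm] at h0
    have h4 := hconn.dist_triangle (u := a) (v := t.1) (w := t.2.1)
    have h5 := hconn.dist_triangle (u := a) (v := t.1) (w := t.2.2)
    simp only [Q, Finset.mem_product, hball]
    omega
  have hmem := mem_Cr_of_family (C := C) (N := N * (N * N)) k c hlen (fun t => by
    simp only [k]; split_ifs
    · exact hgC _ _ _
    · simp) (fun a => Q a ×ˢ Q a ×ˢ Q a) (fun a => by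
      rw [Finset.card_product, Finset.card_product]
      exact Nat.mul_le_mul (hN a) (Nat.mul_le_mul (hN a) (hN a))) hT
  convert hmem using 1
  funext a b
  have hchain : ∀ t, walkChain (c t).2 a b = walkChain (p t.1 t.2.1) a b +
      walkChain (p t.2.1 t.2.2) a b - walkChain (p t.1 t.2.2) a b := fun t => by
    simp only [c, walkChain_append, walkChain_reverse]; ring
  rw [finsum_eq_sum_of_mem (Q a ×ˢ Q a ×ˢ Q a) fun t ht => hT t (left_ne_zero_of_mul ht) a
    (adj_of_walkChain_ne_zero (right_ne_zero_of_mul ht)).2.1]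
  simp only [hchain, Finset.sum_product]
  simp only [k]
  rw [sum_triangles hg (fun x y => walkChain (p x y) a b) (Q a), ← finsum_elem1_eq hf.1 a b,
    finsum_eq_sum_of_mem (Q a ×ˢ Q a), Finset.sum_product]
  · refine Finset.sum_congr rfl fun x hx => Finset.sum_congr rfl fun y hy => ?_
    rw [← Finset.mul_sum]
    by_cases hw : walkChain (p x y) a b = 0
    · by_cases hadj : G.Adj x y
      · rw [← walkChain_of_length_eq_one ((hp x y).trans (SimpleGraph.dist_eq_one_iff_adj.2 hadj)),
          hw]
        simp
      · simp [not_not.1 (mt (hf.2 x y) hadj), hw]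
    · have hfg : f x y = ∑ z ∈ Q a, g x y z := by
        rw [← hgf]
        refine finsum_eq_sum_of_mem _ fun z hz => ?_
        obtain ⟨h1, h2, h3⟩ := hdist _ _ _ hz
        have h4 := dist_le_of_mem_support (adj_of_walkChain_ne_zero hw).2.1
        rw [hp, G.dist_comm] at h4
        have h5 := hconn.dist_triangle (u := a) (v := x) (w := z)
        simp only [Q, hball]
        omega
      rw [← hfg]
      by_cases hadj : G.Adj x y
      · rw [walkChain_of_length_eq_one ((hp x y).trans (SimpleGraph.dist_eq_one_iff_adj.2 hadj))]
        split_ifs <;> ring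
      · simp [not_not.1 (mt (hf.2 x y) hadj)]
  · rintro ⟨x, y⟩ hxy
    have h1 := left_ne_zero_of_mul hxy
    have h2 := elem1_ne_zero (right_ne_zero_of_mul hxy)
    have h3 : f x y ≠ 0 := fun h => h1 (by simp [h])
    have h4 : G.dist x y ≤ s := by
      rw [← hgf] at h3
      obtain ⟨z, hz⟩ := exists_ne_zero_of_finsum h3
      exact (hdist _ _ _ hz).1
    have h5 := G.dist_comm (u := x) (v := y)
    simp only [Q, Finset.mem_product, hball]
    rcases h2.2 with ⟨rfl, rfl⟩ | ⟨rfl, rfl⟩ <;> simp <;> omega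

lemma abs_walkChain_le_one {G : SimpleGraph V} {x y : V} {p : G.Walk x y} (hp : p.IsPath)
    (a b : V) : |walkChain p a b| ≤ 1 := by
  induction p with
  | nil => simp [walkChain_nil]
  | @cons u v w h p ih =>
    rw [SimpleGraph.Walk.cons_isPath_iff] at hp
    rw [walkChain_cons]
    by_cases he : elem1 u v a b = 0
    · rw [he, zero_add]
      exact ih hp.1
    · have h0 : walkChain p a b = 0 := by
        by_contra hne
        have h1 := adj_of_walkChain_ne_zero hne
        rcases (elem1_ne_zero he).2 with ⟨rfl, rfl⟩ | ⟨rfl, rfl⟩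
        · exact hp.2 h1.2.1
        · exact hp.2 h1.2.2
      rw [h0, add_zero]
      exact abs_elem1_le u v a b

/-- Total flow of `f` leaving the set `A` inside the finite window `Q`. -/
noncomputable def flux (A : Set V) (Q : Finset V) (f : V → V → ℤ) : ℤ :=
  ∑ a ∈ Q with a ∈ A, ∑ b ∈ Q with b ∉ A, f a b

lemma flux_elem1 {A : Set V} {Q : Finset V} {u v : V}
    (h : u ∈ A → v ∉ A → u ∈ Q ∧ v ∈ Q) (h' : v ∈ A → u ∉ A → u ∈ Q ∧ v ∈ Q) :
    flux A Q (elem1 u v) = (if u ∈ A then 1 else 0) - if v ∈ A then 1 else 0 := by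
  have key : ∀ (s t : Finset V) (x y : V), ∑ a ∈ s, ∑ b ∈ t, delta x a * delta y b =
      if x ∈ s ∧ y ∈ t then 1 else 0 := by
    intro s t x y
    simp only [← Finset.mul_sum, ← Finset.sum_mul]
    by_cases hx : x ∈ s <;> by_cases hy : y ∈ t <;> simp [delta, hx, hy]
  unfold flux elem1
  simp only [Finset.sum_sub_distrib]
  rw [key]
  simp only [mul_comm (delta u _) (delta v _)]
  rw [key]
  simp only [Finset.mem_filter]
  by_cases hu : u ∈ A <;> by_cases hv : v ∈ A <;> simp [hu, hv] <;> aesop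

lemma flux_walkChain {G : SimpleGraph V} {A : Set V} {Q : Finset V}
    (hQ : ∀ u v, G.Adj u v → u ∈ A → v ∉ A → u ∈ Q ∧ v ∈ Q) {x y : V} (p : G.Walk x y) :
    flux A Q (walkChain p) = (if x ∈ A then 1 else 0) - if y ∈ A then 1 else 0 := by
  induction p with
  | nil => simp [flux, walkChain_nil]
  | @cons u v w h p ih =>
    have h1 : flux A Q (walkChain (SimpleGraph.Walk.cons h p)) =
        flux A Q (elem1 u v) + flux A Q (walkChain p) := by
      simp only [flux, walkChain_cons, Finset.sum_add_distrib]
    rw [h1, ih, flux_elem1 (hQ u v h) fun hv hu => (hQ v u h.symm hv hu).symm]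
    ring

lemma flux_bd2 {H : SimpleGraph V} {g : V → V → V → ℤ} (hg : IsChain2 H g) {A : Set V}
    {Q : Finset V} (hQ : ∀ u v, H.Adj u v → u ∈ A → v ∉ A → u ∈ Q ∧ v ∈ Q) :
    flux A Q (bd2 g) = 0 := by
  have h1 : ∀ a ∈ Q.filter (· ∈ A), ∀ b ∈ Q.filter (· ∉ A),
      bd2 g a b = ∑ c ∈ Q with c ∈ A, g a b c + ∑ c ∈ Q with c ∉ A, g a b c := by
    intro a ha b hb
    rw [Finset.sum_filter_add_sum_filter_not]
    refine finsum_eq_sum_of_mem Q fun c hc => ?_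
    obtain ⟨-, hbc, hac⟩ := hg.2.2 a b c hc
    by_cases hcA : c ∈ A
    · exact (hQ c b hbc.symm hcA (Finset.mem_filter.1 hb).2).1
    · exact (hQ a c hac (Finset.mem_filter.1 ha).2 hcA).2
  unfold flux
  rw [Finset.sum_congr rfl fun a ha => Finset.sum_congr rfl fun b hb => h1 a ha b hb]
  simp only [Finset.sum_add_distrib]
  rw [Finset.sum_comm, Finset.sum_eq_zero fun b _ => ?_, zero_add,
    Finset.sum_eq_zero fun a _ => ?_]
  · exact sum_sum_antisymm _ (fun b c => g a b c) fun b c => hg.2.1 a b c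
  · exact sum_sum_antisymm _ (fun a c => g a b c) fun a c => hg.cycle a b c

/-- A pointwise limit of bounded chains whose sources escape to infinity is a flow. -/
lemma exists_flow_of_limit {G : SimpleGraph V} (hG : LocFin G) (F : ℕ → V → V → ℤ) (M : ℕ)
    (hF : ∀ n, IsChain1 G (F n)) (hM : ∀ n, Bdd (F n) M)
    (hd : ∀ v, ∀ᶠ n in Filter.atTop, chainDiv (F n) v = 0) :
    ∃ f ∈ Zsuf1 G, ∀ Q : Finset V, ∃ n, ∀ u ∈ Q, ∀ v ∈ Q, F n u v = f u v := by
  obtain ⟨L, hL⟩ := exists_ultralimit (fun n (t : V × V) => F n t.1 t.2) M fun n t => hM n _ _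
  have hfin : ∀ Q : Finset V, ∀ᶠ n in (Filter.hyperfilter ℕ : Filter ℕ),
      ∀ u ∈ Q, ∀ v ∈ Q, F n u v = L (u, v) := fun Q =>
    (Filter.eventually_all_finset Q).2 fun u _ => (Filter.eventually_all_finset Q).2
      fun v _ => hL (u, v)
  have hpair : ∀ u v, ∃ n, F n u v = L (u, v) ∧ F n v u = L (v, u) := fun u v =>
    ((hL (u, v)).and (hL (v, u))).exists
  have hch : IsChain1 G fun u v => L (u, v) := by
    refine ⟨fun u v => ?_, fun u v huv => ?_⟩
    · obtain ⟨n, h1, h2⟩ := hpair u v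
      simp only [← h1, ← h2]
      exact (hF n).1 u v
    · obtain ⟨n, h1, -⟩ := hpair u v
      exact (hF n).2 u v (by rw [h1]; exact huv)
  refine ⟨fun u v => L (u, v), ⟨hch, ⟨M, fun u v => ?_⟩, fun v => ?_⟩, fun Q => (hfin Q).exists⟩
  · obtain ⟨n, h1, -⟩ := hpair u v
    simp only [← h1]
    exact hM n u v
  · obtain ⟨S, hS⟩ := hG v
    obtain ⟨n, h1, h2⟩ := ((hfin (insert v S)).and (eventually_hyperfilter (hd v))).exists
    rw [← h2]
    unfold chainDiv
    rw [finsum_eq_sum_of_mem S fun u hu => hS u (hch.2 u v hu).symm,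
      finsum_eq_sum_of_mem S fun u hu => hS u ((hF n).2 u v hu).symm]
    exact Finset.sum_congr rfl fun u hu =>
      (h1 u (Finset.mem_insert_of_mem hu) v (Finset.mem_insert_self _ _)).symm

/-- Two ends carry a flow that is not a boundary. -/
lemma not_moreThanOneEnd {G : SimpleGraph V} (hG : LocFin G) (hconn : G.Connected)
    (h : ∀ f ∈ Zsuf1 G, ∃ s C, BdOf (rips G s) C f) : ¬ MoreThanOneEnd G := by
  rintro ⟨K, v, w, hv, hw, hvi, hwi, hvw⟩
  set A := Component G (↑K) v
  have hout : ∀ y ∈ Component G (↑K) w, y ∉ A := fun y hy hyA =>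
    hvw (hyA.2.symm.trans hy.2)
  have hcross : ∀ {s x y}, x ∈ A → y ∉ A → G.dist x y ≤ s →
      x ∈ K.biUnion (fun k => ballF G k s) ∧ y ∈ K.biUnion fun k => ballF G k s := by
    intro s x y hx hy hxy
    obtain ⟨p, hp⟩ := hconn.exists_walk_length_eq_dist x y
    obtain ⟨k, hk, hkK⟩ : ∃ k ∈ p.support, k ∈ K := by
      by_contra! hc
      exact hy ⟨hc y (by simp), ConnAvoiding.trans ⟨p.reverse, by simpa using hc⟩ hx.2⟩
    have h1 := dist_le_of_mem_support hk
    have h2 := dist_le_of_mem_support (p := p.reverse) (x := k) (by simpa using hk)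
    rw [SimpleGraph.Walk.length_reverse] at h2
    simp only [Finset.mem_biUnion, mem_ballF hG hconn]
    exact ⟨⟨k, hkK, by rw [G.dist_comm]; omega⟩, k, hkK, by rw [G.dist_comm]; omega⟩
  have hx : ∀ n, ∃ x ∈ A, x ∉ ballF G v n := fun n => hvi.exists_notMem_finset _
  have hy : ∀ n, ∃ y ∈ Component G (↑K) w, y ∉ ballF G v n := fun n =>
    hwi.exists_notMem_finset _
  choose x hxA hxn using hx
  choose y hyB hyn using hy
  choose p hp using fun n => (hconn.preconnected (x n) (y n)).exists_isPath
  obtain ⟨f, hf, hfQ⟩ := exists_flow_of_limit hG (fun n => walkChain (p n)) 1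
    (fun n => isChain1_walkChain _) (fun n a b => by simpa using abs_walkChain_le_one (hp n) a b)
    fun u => by
      filter_upwards [eventually_mem_ballF hG hconn v u] with n hn
      have h1 : x n ≠ u := fun e => hxn n (e ▸ hn)
      have h2 : y n ≠ u := fun e => hyn n (e ▸ hn)
      rw [chainDiv_walkChain]
      simp [delta, h1, h2]
  obtain ⟨s, C, g, hg, -, rfl⟩ := h f hf
  set Q := K.biUnion fun k => ballF G k (max s 1)
  obtain ⟨n, hn⟩ := hfQ Q
  have h0 : flux A Q (bd2 g) = 0 := flux_bd2 hg fun a b hab ha hb =>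
    hcross ha hb ((rips_adj.1 hab).2.trans (le_max_left _ _))
  have h1 : flux A Q (walkChain (p n)) = 1 := by
    rw [flux_walkChain (fun a b hab ha hb => hcross ha hb
      ((SimpleGraph.dist_eq_one_iff_adj.2 hab).le.trans (le_max_right _ _))),
      if_pos (hxA n), if_neg (hout _ (hyB n)), sub_zero]
  have h2 : flux A Q (walkChain (p n)) = flux A Q (bd2 g) :=
    Finset.sum_congr rfl fun a ha => Finset.sum_congr rfl fun b hb =>
      hn a (Finset.mem_filter.1 ha).1 b (Finset.mem_filter.1 hb).1
  omega

/-- A sequence of finitely supported flows is contained, up to translation, in a single flow; a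
filling of the latter yields fillings of all of them. -/
lemma exists_flow_filling_all {G H : SimpleGraph V} (hinf : Infinite V) (hG : LocFin G)
    (hconn : G.Connected) (htrans : VertexTransitive G)
    (hinv : ∀ φ : G ≃g G, ∀ u v, H.Adj u v → H.Adj (φ u) (φ v)) {M : ℕ}
    (F : ℕ → V → V → ℤ) (U : ℕ → Finset V) (hF : ∀ n, FinFlow H (F n))
    (hM : ∀ n, Bdd (F n) M) :
    ∃ f ∈ Zsuf1 H, ∀ s C, BdOf (rips G s) C f → ∀ n, ∃ g, IsChain2 (rips G s) g ∧ Bdd2 g C ∧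
      ∀ u ∈ U n, ∀ v ∈ U n, bd2 g u v = F n u v := by
  choose T hT using fun n => (hF n).2.1
  obtain ⟨f, hf, φ, hφ⟩ := exists_flow_of_translates hinf hG hconn htrans hinv M F
    (fun n => T n ∪ U n) (fun n => (hF n).1)
    (fun n u v h => ⟨Finset.mem_union_left _ (hT n u v h).1, Finset.mem_union_left _ (hT n u v h).2⟩)
    (fun n => (hF n).2.2) hM
  refine ⟨f, hf, ?_⟩
  rintro s C ⟨g, hg, hC, rfl⟩ n
  have hadj : ∀ u v, (rips G s).Adj (φ n u) (φ n v) → (rips G s).Adj u v := fun u v h => by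
    rw [rips_adj, dist_iso hconn] at h
    exact rips_adj.2 ⟨fun e => h.1 (congrArg _ e), h.2⟩
  refine ⟨fun a b c => g (φ n a) (φ n b) (φ n c), ⟨fun _ _ _ => hg.1 _ _ _,
    fun _ _ _ => hg.2.1 _ _ _, fun a b c h => ?_⟩, fun _ _ _ => hC _ _ _, fun u hu v _ => ?_⟩
  · obtain ⟨h1, h2, h3⟩ := hg.2.2 _ _ _ h
    exact ⟨hadj _ _ h1, hadj _ _ h2, hadj _ _ h3⟩
  · rw [← hφ n u (Finset.mem_union_right _ hu) v]
    exact finsum_comp_equiv (φ n).toEquiv (f := fun c => g (φ n u) (φ n v) c)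

/-- If every flow is filled at some scale then one scale suffices. -/
lemma exists_uniform_scale {G : SimpleGraph V} (hinf : Infinite V) (hG : LocFin G)
    (hconn : G.Connected) (htrans : VertexTransitive G) (hcut : CutFin G)
    (h : ∀ f ∈ Zsuf1 G, ∃ s C, BdOf (rips G s) C f) :
    ∃ s, ∀ f ∈ Zsuf1 G, ∃ C, BdOf (rips G s) C f := by
  by_contra! hc
  obtain ⟨o⟩ := hconn.nonempty
  have key : ∀ n, ∃ F : V → V → ℤ, ∃ U : Finset V, FinFlow G F ∧ Bdd F 1 ∧
      ¬ ∃ g, IsChain2 (rips G n) g ∧ Bdd2 g n ∧ ∀ u ∈ U, ∀ v ∈ U, bd2 g u v = F u v := by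
    intro n
    by_contra hn
    obtain ⟨f, ⟨hf, ⟨M, hM⟩, hd⟩, hfn⟩ := hc n
    obtain ⟨D, hD⟩ := exists_degBdd_rips hG hconn htrans n
    refine hfn (M * n) (bdOf_of_local hD.locFin (fun m => ballF G o m)
      (eventually_mem_ballF hG hconn o) (Filter.Eventually.of_forall fun m => ?_))
    obtain ⟨F, hF, hFM, hFf⟩ := exists_finFlow_extending hG hcut hf hd hM (ballF G o m)
    obtain ⟨g, hg, hgb, hgF⟩ := FinFlow.exists_local_filling (U := ballF G o m) hG hD.locFin
      (fun E hE hE1 => by_contra fun he => hn ⟨E, _, hE, hE1, he⟩) M F hF hFM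
    exact ⟨g, hg, hgb, fun u hu v hv => (hgF u hu v hv).trans (hFf u hu v hv)⟩
  choose F U hF hF1 hFU using key
  obtain ⟨f, hf, hfill⟩ := exists_flow_filling_all hinf hG hconn htrans
    (fun φ u v huv => φ.map_rel_iff.2 huv) F U hF hF1
  obtain ⟨s, C, hsC⟩ := h f hf
  exact hFU (max s C) (hfill _ _ (hsC.mono (rips_mono G (le_max_left s C)) (le_max_right s C)) _)

lemma bdd_chainNorm {f : V → V → ℤ} (h : ∃ C, Bdd f C) : Bdd f (chainNorm f) :=
  Nat.sInf_mem h

lemma exists_abs_eq_chainNorm [Nonempty V] {f : V → V → ℤ} (h : ∃ C, Bdd f C) :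
    ∃ u v, |f u v| = (chainNorm f : ℤ) := by
  have hb := bdd_chainNorm h
  by_contra! hne
  have hlt : ∀ u v, |f u v| < (chainNorm f : ℤ) := fun u v => lt_of_le_of_ne (hb u v) (hne u v)
  have hpos : 0 < chainNorm f := by
    obtain ⟨o⟩ := ‹Nonempty V›
    exact_mod_cast (abs_nonneg _).trans_lt (hlt o o)
  have h1 : chainNorm f ≤ chainNorm f - 1 := Nat.sInf_le fun u v => by
    have := hlt u v
    omega
  omega

lemma chainNorm_eq {f : V → V → ℤ} {M : ℕ} (hM : Bdd f M) {u v : V} (h : |f u v| = (M : ℤ)) :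
    chainNorm f = M := by
  refine le_antisymm (Nat.sInf_le hM) ?_
  have := bdd_chainNorm ⟨M, hM⟩ u v
  rw [h] at this
  exact_mod_cast this

/-- If all flows on a Rips graph are boundaries then it has pure expansion. -/
lemma pureHsufExp1_rips {G : SimpleGraph V} (hinf : Infinite V) (hG : LocFin G)
    (hconn : G.Connected) (htrans : VertexTransitive G) {s : ℕ} (hcut : CutFin (rips G s))
    (h : ∀ f ∈ Zsuf1 (rips G s), ∃ C, BdOf (rips G s) C f) : PureHsufExp1 (rips G s) := by
  obtain ⟨D, hD⟩ := exists_degBdd_rips hG hconn htrans s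
  have key : ∀ M, ∃ K : ℕ, ∀ (U : Finset V) (f fh : V → V → ℤ), chainNorm f = M →
      (∃ C, BdOf (rips G s) C fh) → (∀ u ∈ U, ∀ v ∈ U, fh u v = f u v) →
      chainNorm fh = chainNorm f → ∃ g, IsChain2 (rips G s) g ∧ Bdd2 g K ∧
        ∀ u ∈ U, ∀ v ∈ U, bd2 g u v = f u v := by
    intro M
    by_contra! hc
    choose U f fh hfM hfh hU hnorm hbad using hc
    have hz : ∀ n, fh n ∈ Zsuf1 (rips G s) := fun n => (hfh n).choose_spec.mem_zsuf hD
    have hb : ∀ n, Bdd (fh n) M := fun n => by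
      have := bdd_chainNorm (hz n).2.1
      rwa [hnorm, hfM] at this
    choose F hF hFM hFU using fun n =>
      exists_finFlow_extending hD.locFin hcut (hz n).1 (hz n).2.2 (hb n) (U n)
    obtain ⟨e, he, hfill⟩ := exists_flow_filling_all hinf hG hconn htrans
      (fun φ u v huv => by
        rw [rips_adj] at huv ⊢
        rw [dist_iso hconn]
        exact ⟨fun e => huv.1 (φ.injective e), huv.2⟩) F U hF hFM
    obtain ⟨C, hC⟩ := h e he
    obtain ⟨g, hg, hgC, hgU⟩ := hfill s C hC C
    obtain ⟨u, hu, v, hv, hne⟩ := hbad C g hg hgC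
    exact hne (by rw [hgU u hu v hv, hFU C u hu v hv, hU C u hu v hv])
  choose K hK using key
  refine ⟨K, fun U f _ _ _ hex => ?_⟩
  obtain ⟨fh, -, ⟨g2, hg2, ⟨C, hC⟩, rfl⟩, hU, hnorm⟩ := hex
  exact hK _ U f _ rfl ⟨C, g2, hg2, hC, rfl⟩ hU hnorm

/-- One end, circuits generated in bounded length and pure expansion make every flow a
bounded sum of short circuits. -/
lemma zsuf1_subset_Cinf {G : SimpleGraph V} (hG : LocFin G) (hconn : G.Connected)
    (htrans : VertexTransitive G) (hcut : CutFin G) {r : ℕ} (hr : Cr G r = Cinf G)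
    (hexp : PureHufExp1 G) : Zsuf1 G ⊆ Cinf G := by
  rintro f ⟨hf, hb, hd⟩
  obtain ⟨s₀, hs₀⟩ := hexp
  set s := max s₀ (max r 1)
  have hr_s : r ≤ s := (le_max_left _ _).trans (le_max_right _ _)
  have hs : 1 ≤ s := (le_max_right _ _).trans (le_max_right _ _)
  obtain ⟨K, hK⟩ := hs₀ s (le_max_left _ _)
  have hne := hconn.nonempty
  obtain ⟨u₀, v₀, huv⟩ := exists_abs_eq_chainNorm hb
  have hM := bdd_chainNorm hb
  obtain ⟨D, hD⟩ := exists_degBdd_rips hG hconn htrans s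
  refine Set.mem_iUnion.2 ⟨3 * s, mem_Cr_of_bdOf (C := K (chainNorm f)) hG hconn htrans hf
    (bdOf_of_local hD.locFin (fun m => ballF G u₀ m) (eventually_mem_ballF hG hconn u₀) ?_)⟩
  filter_upwards [eventually_mem_ballF hG hconn u₀ u₀, eventually_mem_ballF hG hconn u₀ v₀]
    with n hu₀ hv₀
  set U := ballF G u₀ n
  obtain ⟨F, hF, hFM, hFU⟩ := exists_finFlow_extending hG hcut hf hd hM U
  let f' : V → V → ℤ := fun u v => if u ∈ U ∧ v ∈ U then f u v else 0
  have hf'U : ∀ u ∈ U, ∀ v ∈ U, f' u v = f u v := fun u hu v hv => if_pos ⟨hu, hv⟩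
  have hf'M : Bdd f' (chainNorm f) := fun u v => by
    simp only [f']
    split_ifs
    · exact hM u v
    · simp
  have hf'ne : ∀ u v, f' u v ≠ 0 → (u ∈ U ∧ v ∈ U) ∧ f u v ≠ 0 := fun u v h => by
    by_cases hc : u ∈ U ∧ v ∈ U
    · exact ⟨hc, by rwa [hf'U u hc.1 v hc.2] at h⟩
    · exact absurd (if_neg hc) h
  have hnorm' : chainNorm f' = chainNorm f :=
    chainNorm_eq hf'M (u := u₀) (v := v₀) (by rw [hf'U _ hu₀ _ hv₀, huv])
  have hnormF : chainNorm F = chainNorm f :=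
    chainNorm_eq hFM (u := u₀) (v := v₀) (by rw [hFU _ hu₀ _ hv₀, huv])
  obtain ⟨g, hg, hgb, hgU⟩ := hK U f'
    ⟨fun u v => by simp only [f', and_comm, hf.1 u v]; split_ifs <;> simp,
      fun u v h => le_rips G hs (hf.2 u v (hf'ne u v h).2)⟩ (fun u v h => (hf'ne u v h).1)
    (fun v hv hnb => by
      rw [← hd v]
      refine finsum_congr fun u => ?_
      by_cases h0 : f u v = 0
      · by_contra hc
        exact (hf'ne u v fun h => hc (h.trans h0.symm)).2 h0
      · exact hf'U u (hnb u (le_rips G hs (hf.2 u v h0))) v hv)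
    ⟨F, hF.1.mono (le_rips G hs), by
      obtain ⟨t, ht⟩ := hF.exists_bdOf hconn hFM
      have h1 : F ∈ Cinf G := Set.mem_iUnion.2 ⟨_, mem_Cr_of_bdOf hG hconn htrans hF.1 ht⟩
      rw [← hr] at h1
      obtain ⟨-, C, g, hg, hgC, hgF⟩ := exists_bdOf_of_mem_Cr hG hconn htrans hs hr_s h1
      exact ⟨g, hg, ⟨C, hgC⟩, hgF⟩, fun u hu v hv => (hFU u hu v hv).trans (hf'U u hu v hv).symm,
      hnormF.trans hnorm'.symm⟩
  rw [hnorm'] at hgb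
  exact ⟨g, hg, hgb, fun u hu v hv => (hgU u hu v hv).trans (hf'U u hu v hv)⟩

/-- the H^uf_1 triad for transitive graphs: nonvanishing iff
ends, ℤ-large circuits, or failure of pure H^uf_1-expansion. -/
theorem stmt19 (G : SimpleGraph V) (hinf : Infinite V) (hconn : G.Connected)
    (htrans : VertexTransitive G) (hulf : ULF G) :
    (∃ f ∈ Zsuf1 G, f ∉ Cinf G) ↔
      (MoreThanOneEnd G ∨ (∀ r : ℕ, Cr G r ≠ Cinf G) ∨ ¬ PureHufExp1 G) := by
  have hG := hulf.locFin
  rw [← not_iff_not]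
  constructor
  · intro h
    push Not at h
    have hfill : ∀ f ∈ Cinf G, IsChain1 G f ∧ ∃ s C, BdOf (rips G s) C f := by
      intro f hf
      obtain ⟨r, hr⟩ := Set.mem_iUnion.1 hf
      obtain ⟨h1, C, hC⟩ := exists_bdOf_of_mem_Cr hG hconn htrans (le_max_right r 1)
        (le_max_left r 1) hr
      exact ⟨h1, _, C, hC⟩
    have hbd : ∀ f ∈ Zsuf1 G, ∃ s C, BdOf (rips G s) C f := fun f hf => (hfill f (h f hf)).2
    have hend := not_moreThanOneEnd hG hconn hbd
    have hcut := cutFin_of_not_moreThanOneEnd hG hconn hend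
    obtain ⟨n, hn⟩ := exists_uniform_scale hinf hG hconn htrans hcut hbd
    have hzsuf : ∀ f ∈ Cinf G, f ∈ Zsuf1 G := by
      intro f hf
      obtain ⟨h1, s, C, hC⟩ := hfill f hf
      obtain ⟨D, hD⟩ := exists_degBdd_rips hG hconn htrans s
      exact ⟨h1, (hC.mem_zsuf hD).2⟩
    rintro (h1 | h1 | h1)
    · exact hend h1
    · refine h1 (3 * n) (Set.Subset.antisymm (Set.subset_iUnion _ _) fun f hf => ?_)
      have hfz := hzsuf f hf
      obtain ⟨C, hC⟩ := hn f hfz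
      exact mem_Cr_of_bdOf hG hconn htrans hfz.1 hC
    · refine h1 ⟨max n 1, fun s hs => ?_⟩
      have hs1 : 1 ≤ s := (le_max_right _ _).trans hs
      refine pureHsufExp1_rips hinf hG hconn htrans (hcut.mono (le_rips G hs1)) fun F hF =>
        exists_bdOf_rips hG hconn htrans hs1 (fun f hf => ?_) hF
      obtain ⟨C, hC⟩ := hn f hf
      exact ⟨C, hC.mono (rips_mono G ((le_max_left _ _).trans hs)) le_rfl⟩
  · intro h
    push Not at h
    obtain ⟨h1, ⟨r, hr⟩, h3⟩ := h
    push Not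
    exact fun f hf => zsuf1_subset_Cinf hG hconn htrans
      (cutFin_of_not_moreThanOneEnd hG hconn h1) hr h3 hf

end UFH
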